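/- There exist constants 0 < c ≤ C < ∞ such that for every integer n ≥ 1 and every integer 1 ≤ m ≤ n, c·m/n ≤ P(M_n^{hc} < m) ≤ C·m/n, where M_n^{hc} is the minimum height above the bottom of B(n) attained by a site of the highest horizontal open crossing of B(n) when such a crossing exists, and M_n^{hc} := 2n otherwise. -/

import Mathlib

/-!
Critical site percolation on the triangular lattice realized on `ℤ²`.
A configuration assigns to each site `true` (open) or `false` (closed),
and `P` is the product Bernoulli(1/2) measure, axiomatized by
`IsBernoulliHalf` below (finite cylinder events have product probability).
-/

open MeasureTheory
open scoped ENNReal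

/-- Sites of the lattice: vertices of `ℤ²`. -/
abbrev Site : Type := ℤ × ℤ

/-- A percolation configuration: `true` = open, `false` = closed. -/
abbrev Config : Type := Site → Bool

/-- Adjacency for the triangular lattice realized on `ℤ²`:
the neighbors of `(x,y)` are `(x±1,y)`, `(x,y±1)`, `(x+1,y-1)`, `(x-1,y+1)`. -/
def Adj (a b : Site) : Prop :=
  (b.1 - a.1, b.2 - a.2) ∈
    ({(1, 0), (-1, 0), (0, 1), (0, -1), (1, -1), (-1, 1)} : Set (ℤ × ℤ))

/-- A (nonempty, self-avoiding) lattice path: a list of distinct sites in which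
consecutive sites are neighbors. -/
def IsPath (p : List Site) : Prop := p ≠ [] ∧ p.Nodup ∧ p.Chain' Adj

/-- A path all of whose vertices lie in the set `S`. -/
def PathIn (S : Set Site) (p : List Site) : Prop := IsPath p ∧ ∀ v ∈ p, v ∈ S

/-- All sites of `p` are open in `ω`. -/
def IsOpenOn (ω : Config) (p : List Site) : Prop := ∀ v ∈ p, ω v = true

/-- All sites of `p` are closed in `ω`. -/
def IsClosedOn (ω : Config) (p : List Site) : Prop := ∀ v ∈ p, ω v = false

/-- The first vertex of `p` lies in `A`. -/
def FirstIn (A : Set Site) (p : List Site) : Prop := ∃ a ∈ A, p.head? = some a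

/-- The last vertex of `p` lies in `A`. -/
def LastIn (A : Set Site) (p : List Site) : Prop := ∃ a ∈ A, p.getLast? = some a

/-- `μ` is the product Bernoulli(1/2) measure on configurations: a probability
measure for which every finite cylinder event has the product probability. -/
def IsBernoulliHalf (μ : Measure Config) : Prop :=
  IsProbabilityMeasure μ ∧
    ∀ (S : Finset Site) (f : Site → Bool),
      μ {ω | ∀ v ∈ S, ω v = f v} = (1 / 2 : ℝ≥0∞) ^ S.card

/-- The lattice rectangle `[x₀,x₁] × [y₀,y₁]`. -/
def rect (x₀ x₁ y₀ y₁ : ℤ) : Set Site :=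
  {v | x₀ ≤ v.1 ∧ v.1 ≤ x₁ ∧ y₀ ≤ v.2 ∧ v.2 ≤ y₁}

/-- The left side of a rectangle. -/
def rectLeft (x₀ x₁ y₀ y₁ : ℤ) : Set Site := {v ∈ rect x₀ x₁ y₀ y₁ | v.1 = x₀}

/-- The right side of a rectangle. -/
def rectRight (x₀ x₁ y₀ y₁ : ℤ) : Set Site := {v ∈ rect x₀ x₁ y₀ y₁ | v.1 = x₁}

/-- The top side of a rectangle. -/
def rectTop (x₀ x₁ y₀ y₁ : ℤ) : Set Site := {v ∈ rect x₀ x₁ y₀ y₁ | v.2 = y₁}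

/-- The bottom side of a rectangle. -/
def rectBot (x₀ x₁ y₀ y₁ : ℤ) : Set Site := {v ∈ rect x₀ x₁ y₀ y₁ | v.2 = y₀}

/-- A horizontal open crossing of the rectangle `[x₀,x₁] × [y₀,y₁]`:
an open path in the rectangle from its left side to its right side. -/
def HorizCrossing (x₀ x₁ y₀ y₁ : ℤ) (ω : Config) (p : List Site) : Prop :=
  PathIn (rect x₀ x₁ y₀ y₁) p ∧ IsOpenOn ω p ∧
    FirstIn (rectLeft x₀ x₁ y₀ y₁) p ∧ LastIn (rectRight x₀ x₁ y₀ y₁) p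

/-- The set of sites of the rectangle lying on or above the path `q`: sites
that are on `q` or cannot be joined to the bottom side of the rectangle by a
lattice path avoiding `q`. -/
def OnOrAbove (x₀ x₁ y₀ y₁ : ℤ) (q : List Site) : Set Site :=
  {v ∈ rect x₀ x₁ y₀ y₁ | v ∈ q ∨
    ¬ ∃ r : List Site, PathIn (rect x₀ x₁ y₀ y₁ \ {w | w ∈ q}) r ∧
        r.head? = some v ∧ LastIn (rectBot x₀ x₁ y₀ y₁) r}

/-- `p` is the highest horizontal open crossing of the rectangle: it is a
horizontal open crossing lying on or above every horizontal open crossing. -/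
def IsHighestCrossing (x₀ x₁ y₀ y₁ : ℤ) (ω : Config) (p : List Site) : Prop :=
  HorizCrossing x₀ x₁ y₀ y₁ ω p ∧
    ∀ q, HorizCrossing x₀ x₁ y₀ y₁ ω q → ∀ v ∈ p, v ∈ OnOrAbove x₀ x₁ y₀ y₁ q

/-- `M_n^{hc}`: the minimum height above the bottom of `B(n)` attained by a
site of the highest horizontal open crossing of `B(n)`, when such a crossing
exists; `2n` otherwise. -/
noncomputable def Mhc (n : ℕ) (ω : Config) : ℕ := by
  classical
  exact if ∃ p, IsHighestCrossing (-(n : ℤ)) n (-(n : ℤ)) n ω p then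
      sInf {h : ℕ | ∃ p, IsHighestCrossing (-(n : ℤ)) n (-(n : ℤ)) n ω p ∧
        ∃ v ∈ p, v.2 + (n : ℤ) = (h : ℤ)}
    else 2 * n

theorem adj_iff {a b : Site} : Adj a b ↔
    (b.1 = a.1 + 1 ∧ b.2 = a.2) ∨ (b.1 = a.1 - 1 ∧ b.2 = a.2) ∨
    (b.1 = a.1 ∧ b.2 = a.2 + 1) ∨ (b.1 = a.1 ∧ b.2 = a.2 - 1) ∨
    (b.1 = a.1 + 1 ∧ b.2 = a.2 - 1) ∨ (b.1 = a.1 - 1 ∧ b.2 = a.2 + 1) := by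
  simp only [Adj, Set.mem_insert_iff, Set.mem_singleton_iff, Prod.mk.injEq]
  omega

theorem Adj.symm {a b : Site} (h : Adj a b) : Adj b a := by
  rw [adj_iff] at *
  omega

/-- `u` and `v` are joined by a lattice walk inside `S`. -/
def Conn (S : Set Site) (u v : Site) : Prop :=
  u ∈ S ∧ Relation.ReflTransGen (fun a b => Adj a b ∧ b ∈ S) u v

namespace Conn

variable {S S' A : Set Site} {u v w : Site}

theorem left_mem (h : Conn S u v) : u ∈ S := h.1

theorem right_mem (h : Conn S u v) : v ∈ S := by
  obtain ⟨hu, h⟩ := h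
  induction h with
  | refl => exact hu
  | tail _ h2 _ => exact h2.2

theorem refl (h : u ∈ S) : Conn S u u := ⟨h, .refl⟩

theorem trans (h : Conn S u v) (h' : Conn S v w) : Conn S u w := ⟨h.1, h.2.trans h'.2⟩

theorem tail (h : Conn S u v) (hvw : Adj v w) (hw : w ∈ S) : Conn S u w :=
  ⟨h.1, h.2.tail ⟨hvw, hw⟩⟩

theorem head (hu : u ∈ S) (huv : Adj u v) (h : Conn S v w) : Conn S u w :=
  ((refl hu).tail huv h.1).trans h

theorem symm (h : Conn S u v) : Conn S v u := by
  obtain ⟨hu, h⟩ := h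
  induction h with
  | refl => exact refl hu
  | tail h1 h2 ih => exact head h2.2 h2.1.symm ih

theorem mono (hS : S ⊆ S') (h : Conn S u v) : Conn S' u v :=
  ⟨hS h.1, Relation.ReflTransGen.mono (fun _ _ h => ⟨h.1, hS h.2⟩) _ _ h.2⟩

theorem head_induct {P : Site → Prop} (h : Conn S u v) (base : v ∈ S → P v)
    (step : ∀ a b, a ∈ S → Adj a b → Conn S b v → P b → P a) : P u := by
  obtain ⟨hv, h'⟩ := h.symm
  clear h
  have key : Conn S u v ∧ P u := by
    induction h' with
    | refl => exact ⟨refl hv, base hv⟩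
    | @tail x y h1 h2 ih =>
      exact ⟨head h2.2 h2.1.symm ih.1, step _ _ h2.2 h2.1.symm ih.1 ih.2⟩
  exact key.2

theorem first_exit (h : Conn S u v) (hu : u ∈ A) (hv : v ∉ A) :
    ∃ a b, Conn (S ∩ A) u a ∧ Adj a b ∧ b ∈ S ∧ b ∉ A ∧ Conn S b v := by
  revert hu
  refine h.head_induct (P := fun u => u ∈ A →
    ∃ a b, Conn (S ∩ A) u a ∧ Adj a b ∧ b ∈ S ∧ b ∉ A ∧ Conn S b v) ?_ ?_
  · intro _ hu
    exact absurd hu hv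
  · intro a b ha hab hbv ih haA
    by_cases hb : b ∈ A
    · obtain ⟨c, d, h1, h2⟩ := ih hb
      exact ⟨c, d, head ⟨ha, haA⟩ hab h1, h2⟩
    · exact ⟨a, b, refl ⟨ha, haA⟩, hab, hbv.1, hb, hbv⟩

theorem last_exit (h : Conn S u v) (hu : u ∈ A) (hv : v ∉ A) :
    ∃ a b, a ∈ S ∧ a ∈ A ∧ Adj a b ∧ Conn (S \ A) b v := by
  obtain ⟨b, a, h1, h2, h3, h4, -⟩ :=
    h.symm.first_exit (A := Aᶜ) hv (by simpa using hu)
  refine ⟨a, b, h3, by simpa using h4, h2.symm, ?_⟩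
  rw [Set.sdiff_eq]
  exact h1.symm

theorem subset_or_first_exit (h : Conn S u v) (hu : u ∈ A) :
    Conn (S ∩ A) u v ∨
      ∃ a b, Conn (S ∩ A) u a ∧ Adj a b ∧ b ∈ S ∧ b ∉ A ∧ Conn S b v := by
  revert hu
  refine h.head_induct (P := fun u => u ∈ A → Conn (S ∩ A) u v ∨
    ∃ a b, Conn (S ∩ A) u a ∧ Adj a b ∧ b ∈ S ∧ b ∉ A ∧ Conn S b v) ?_ ?_
  · intro hv hu
    exact .inl (refl ⟨hv, hu⟩)
  · intro a b ha hab hbv ih haA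
    by_cases hb : b ∈ A
    · rcases ih hb with h1 | ⟨c, d, h1, h2⟩
      · exact .inl (head ⟨ha, haA⟩ hab h1)
      · exact .inr ⟨c, d, head ⟨ha, haA⟩ hab h1, h2⟩
    · exact .inr ⟨a, b, refl ⟨ha, haA⟩, hab, hbv.1, hb, hbv⟩

/-- All vertices on a walk from `u` can be taken joined to `u`. -/
theorem component (h : Conn S u v) : Conn {w | Conn S u w} u v := by
  obtain ⟨hu, h⟩ := h
  induction h with
  | refl => exact refl (refl hu)
  | @tail x y h1 h2 ih => exact ih.tail h2.1 (ih.right_mem.tail h2.1 h2.2)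

theorem seq (h : Conn S u v) : ∃ (m : ℕ) (f : ℕ → Site), f 0 = u ∧ f m = v ∧
    (∀ i < m, Adj (f i) (f (i + 1))) ∧ ∀ i ≤ m, f i ∈ S := by
  refine h.head_induct (P := fun u => ∃ (m : ℕ) (f : ℕ → Site), f 0 = u ∧ f m = v ∧
    (∀ i < m, Adj (f i) (f (i + 1))) ∧ ∀ i ≤ m, f i ∈ S) ?_ ?_
  · intro hv
    exact ⟨0, fun _ => v, rfl, rfl, by simp, fun _ _ => hv⟩
  · rintro a b ha hab - ⟨m, f, h0, hm, h1, h2⟩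
    refine ⟨m + 1, fun i => if i = 0 then a else f (i - 1), by simp, by simpa using hm, ?_, ?_⟩
    · intro i hi
      rcases i with _ | i
      · simpa [h0] using hab
      · simpa using h1 i (by omega)
    · intro i hi
      rcases i with _ | i
      · simpa using ha
      · simpa using h2 i (by omega)

end Conn

theorem sum_boundary_eq (a c : ℕ → ℕ → ℤ) (m l : ℕ)
    (h : ∀ i < m, ∀ j < l, a i j + c (i + 1) j = c i j + a i (j + 1)) :
    ∑ i ∈ Finset.range m, a i 0 + ∑ j ∈ Finset.range l, c m j =
      ∑ j ∈ Finset.range l, c 0 j + ∑ i ∈ Finset.range m, a i l := by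
  induction l with
  | zero => simp
  | succ l ih =>
    have row : ∀ k ≤ m, ∑ i ∈ Finset.range k, a i l + c k l =
        c 0 l + ∑ i ∈ Finset.range k, a i (l + 1) := by
      intro k hk
      induction k with
      | zero => simp
      | succ k ihk =>
        rw [Finset.sum_range_succ, Finset.sum_range_succ]
        have := ihk (by omega)
        have := h k (by omega) l (by omega)
        linarith
    have h1 := ih (fun i hi j hj => h i hi j (by omega))
    have h2 := row m le_rfl
    rw [Finset.sum_range_succ, Finset.sum_range_succ]
    linarith

/-- Signed crossing number of a lattice step with a half-line issued from the origin. -/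
def rayCross (z z' : Site) : ℤ :=
  if z.2 = 0 ∧ z'.2 = 1 ∧ 0 < z.1 then 1
  else if z.2 = 1 ∧ z'.2 = 0 ∧ 0 < z'.1 then -1 else 0

/-- Equal or adjacent sites. -/
def Near (a b : Site) : Prop :=
  (-1 ≤ b.1 - a.1 ∧ b.1 - a.1 ≤ 1) ∧ (-1 ≤ b.2 - a.2 ∧ b.2 - a.2 ≤ 1) ∧
    -1 ≤ b.1 - a.1 + (b.2 - a.2) ∧ b.1 - a.1 + (b.2 - a.2) ≤ 1

theorem Adj.near {a b : Site} (h : Adj a b) : Near a b := by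
  rw [adj_iff] at h
  simp only [Near]
  omega

theorem rayCross_triangle {a b c : Site} (ha : a ≠ 0) (hb : b ≠ 0) (hc : c ≠ 0)
    (hab : Near a b) (hbc : Near b c) (hac : Near a c) :
    rayCross a b + rayCross b c = rayCross a c := by
  obtain ⟨a1, a2⟩ := a
  obtain ⟨b1, b2⟩ := b
  obtain ⟨c1, c2⟩ := c
  simp only [ne_eq, Prod.mk_eq_zero, rayCross, Near] at *
  split_ifs <;> omega

theorem rayCross_square {a b c d : Site} (ha : a ≠ 0) (hb : b ≠ 0) (hc : c ≠ 0) (hd : d ≠ 0)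
    (hab : Adj a b) (hac : Adj a c) (h1 : d.1 = b.1 + c.1 - a.1) (h2 : d.2 = b.2 + c.2 - a.2) :
    rayCross a b + rayCross b d = rayCross a c + rayCross c d := by
  have nab := hab.near
  have nac := hac.near
  have nbd : Near b d := by simp only [Near] at *; omega
  have ncd : Near c d := by simp only [Near] at *; omega
  by_cases hbc : Near b c
  · have e1 := rayCross_triangle ha hb hc nab hbc nac
    have e2 := rayCross_triangle hb hc hd hbc ncd nbd
    linarith
  · have had : Near a d := by
      rw [adj_iff] at hab hac
      simp only [Near] at *
      omega
    have e1 := rayCross_triangle ha hb hd nab nbd had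
    have e2 := rayCross_triangle ha hc hd nac ncd had
    linarith

/-- A left-right walk and a top-bottom walk of a rectangle share a site. -/
theorem crossings_meet {x₀ x₁ y₀ y₁ : ℤ} {p s : Set Site} (hp : p ⊆ rect x₀ x₁ y₀ y₁)
    (hs : s ⊆ rect x₀ x₁ y₀ y₁) {u v t b : Site} (huv : Conn p u v) (htb : Conn s t b)
    (hu : u.1 = x₀) (hv : v.1 = x₁) (ht : t.2 = y₁) (hb : b.2 = y₀) : (p ∩ s).Nonempty := by
  by_contra hne
  obtain ⟨m, f, f0, fm, fadj, fS⟩ := huv.seq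
  obtain ⟨l, g, g0, gl, gadj, gS⟩ := htb.seq
  have hd : ∀ i ≤ m, ∀ j ≤ l, f i - g j ≠ 0 := by
    intro i hi j hj h
    exact hne ⟨f i, fS i hi, by rw [sub_eq_zero.1 h]; exact gS j hj⟩
  have fR := fun i hi => hp (fS i hi)
  have gR := fun j hj => hs (gS j hj)
  simp only [rect, Set.mem_ofPred_eq] at fR gR
  have key := sum_boundary_eq (fun i j => rayCross (f i - g j) (f (i + 1) - g j))
    (fun i j => rayCross (f i - g j) (f i - g (j + 1))) m l (by
      intro i hi j hj
      refine rayCross_square (hd _ (by omega) _ (by omega)) (hd _ (by omega) _ (by omega))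
        (hd _ (by omega) _ (by omega)) (hd _ (by omega) _ (by omega)) ?_ ?_ ?_ ?_
      · have := fadj i hi
        rw [adj_iff] at *
        simp only [Prod.fst_sub, Prod.snd_sub]
        omega
      · have := gadj j hj
        rw [adj_iff] at *
        simp only [Prod.fst_sub, Prod.snd_sub]
        omega
      · simp only [Prod.fst_sub]
        ring
      · simp only [Prod.snd_sub]
        ring)
  have e1 : ∑ i ∈ Finset.range m, rayCross (f i - g 0) (f (i + 1) - g 0) = 0 := by
    refine Finset.sum_eq_zero fun i hi => ?_
    rw [Finset.mem_range] at hi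
    have h1 := fR i (by omega)
    have h2 := fR (i + 1) (by omega)
    simp only [rayCross, Prod.fst_sub, Prod.snd_sub]
    rw [if_neg (by rw [g0]; omega), if_neg (by rw [g0]; omega)]
  have e2 : ∑ j ∈ Finset.range l, rayCross (f 0 - g j) (f 0 - g (j + 1)) = 0 := by
    refine Finset.sum_eq_zero fun j hj => ?_
    rw [Finset.mem_range] at hj
    have h1 := gR j (by omega)
    have h2 := gR (j + 1) (by omega)
    simp only [rayCross, Prod.fst_sub, Prod.snd_sub]
    rw [if_neg (by rw [f0]; omega), if_neg (by rw [f0]; omega)]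
  have hne0 : ∀ z : Site, z ≠ 0 → ¬ (z.1 = 0 ∧ z.2 = 0) := by
    intro z hz h
    exact hz (Prod.ext h.1 h.2)
  have e3 : ∑ j ∈ Finset.range l, rayCross (f m - g j) (f m - g (j + 1)) =
      (if 1 ≤ (f m - g l).2 then 1 else 0) - (if 1 ≤ (f m - g 0).2 then 1 else 0) := by
    rw [← Finset.sum_range_sub (fun j => if 1 ≤ (f m - g j).2 then (1 : ℤ) else 0)]
    refine Finset.sum_congr rfl fun j hj => ?_
    rw [Finset.mem_range] at hj
    have h1 := gR j (by omega)
    have h2 := gR (j + 1) (by omega)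
    have h3 := hne0 _ (hd m le_rfl j (by omega))
    have h4 := hne0 _ (hd m le_rfl (j + 1) (by omega))
    have h5 := gadj j hj
    rw [adj_iff] at h5
    simp only [rayCross, Prod.fst_sub, Prod.snd_sub] at *
    rw [fm] at *
    split_ifs <;> omega
  have e4 : ∑ i ∈ Finset.range m, rayCross (f i - g l) (f (i + 1) - g l) =
      (if (f m - g l).2 = 0 ∧ 0 < (f m - g l).1 then 0 else 1) -
        (if (f 0 - g l).2 = 0 ∧ 0 < (f 0 - g l).1 then 0 else 1) := by
    rw [← Finset.sum_range_sub
      (fun i => if (f i - g l).2 = 0 ∧ 0 < (f i - g l).1 then (0 : ℤ) else 1)]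
    refine Finset.sum_congr rfl fun j hj => ?_
    rw [Finset.mem_range] at hj
    have h1 := fR j (by omega)
    have h2 := fR (j + 1) (by omega)
    have h3 := hne0 _ (hd j (by omega) l le_rfl)
    have h4 := hne0 _ (hd (j + 1) (by omega) l le_rfl)
    have h5 := fadj j hj
    rw [adj_iff] at h5
    simp only [rayCross, Prod.fst_sub, Prod.snd_sub] at *
    rw [gl] at *
    split_ifs <;> omega
  beta_reduce at key
  rw [e1, e2, e3, e4] at key
  have h1 := hne0 _ (hd m le_rfl l le_rfl)
  have h2 := gR l le_rfl
  have h3 := fR m le_rfl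
  have h4 := fR 0 (by omega)
  simp only [Prod.fst_sub, Prod.snd_sub] at *
  rw [g0, f0, fm, gl] at *
  split_ifs at key <;> omega

/-- Labels `a`, `b` that adjacent sites may carry in the proof of `hex`. -/
def compat (a b : Fin 4) : Bool :=
  !((a == 0 && b == 1) || (a == 1 && b == 0) || (a == 2 && b == 3) || (a == 3 && b == 2))

/-- Signed number of label changes between `0` and `2`. -/
def labelCross (a b : Fin 4) : ℤ :=
  if a = 0 ∧ b = 2 then 1 else if a = 2 ∧ b = 0 then -1 else 0

theorem labelCross_triangle : ∀ a b c : Fin 4, compat a b → compat b c → compat a c →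
    labelCross a b + labelCross b c = labelCross a c := by
  decide

/-- A rectangle has a left-right walk inside `C` or a top-bottom walk avoiding `C`. -/
theorem hex {x₀ x₁ y₀ y₁ : ℤ} (hx : x₀ ≤ x₁) (hy : y₀ ≤ y₁) (C : Set Site) :
    (∃ u v, u.1 = x₀ ∧ v.1 = x₁ ∧ Conn (rect x₀ x₁ y₀ y₁ ∩ C) u v) ∨
      ∃ t b, t.2 = y₁ ∧ b.2 = y₀ ∧ Conn (rect x₀ x₁ y₀ y₁ \ C) t b := by
  classical
  by_contra hcon
  push Not at hcon
  obtain ⟨hLR, hTB⟩ := hcon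
  set Rc := rect x₀ x₁ y₀ y₁ with hRc
  let lab : Site → Fin 4 := fun v =>
    if v ∈ C then (if ∃ u, u.1 = x₀ ∧ Conn (Rc ∩ C) u v then 0 else 1)
    else (if ∃ t, t.2 = y₁ ∧ Conn (Rc \ C) t v then 2 else 3)
  have lab0 : ∀ v, lab v = 0 ↔ v ∈ C ∧ ∃ u, u.1 = x₀ ∧ Conn (Rc ∩ C) u v := by
    intro v
    simp only [lab]
    split_ifs <;> simp_all
  have lab1 : ∀ v, lab v = 1 ↔ v ∈ C ∧ ¬ ∃ u, u.1 = x₀ ∧ Conn (Rc ∩ C) u v := by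
    intro v
    simp only [lab]
    split_ifs <;> simp_all
  have lab2 : ∀ v, lab v = 2 ↔ v ∉ C ∧ ∃ u, u.2 = y₁ ∧ Conn (Rc \ C) u v := by
    intro v
    simp only [lab]
    split_ifs <;> simp_all
  have lab3 : ∀ v, lab v = 3 ↔ v ∉ C ∧ ¬ ∃ u, u.2 = y₁ ∧ Conn (Rc \ C) u v := by
    intro v
    simp only [lab]
    split_ifs <;> simp_all
  clear_value lab
  have hcompat : ∀ a ∈ Rc, ∀ b ∈ Rc, Adj a b → compat (lab a) (lab b) := by
    have key : ∀ a ∈ Rc, ∀ b ∈ Rc, Adj a b →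
        ¬ (lab a = 0 ∧ lab b = 1) ∧ ¬ (lab a = 2 ∧ lab b = 3) := by
      intro a ha b hb hab
      rw [lab0, lab1, lab2, lab3]
      constructor
      · rintro ⟨⟨h1, u, hu, hc⟩, h2, h3⟩
        exact h3 ⟨u, hu, hc.tail hab ⟨hb, h2⟩⟩
      · rintro ⟨⟨h1, u, hu, hc⟩, h2, h3⟩
        exact h3 ⟨u, hu, hc.tail hab ⟨hb, h2⟩⟩
    intro a ha b hb hab
    have h1 := key a ha b hb hab
    have h2 := key b hb a ha hab.symm
    revert h1 h2
    generalize lab a = i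
    generalize lab b = j
    revert i j
    decide
  obtain ⟨m, hm⟩ := Int.eq_ofNat_of_zero_le (sub_nonneg.2 hx)
  obtain ⟨l, hl⟩ := Int.eq_ofNat_of_zero_le (sub_nonneg.2 hy)
  let P : ℕ → ℕ → Site := fun i j => (x₀ + i, y₀ + j)
  have hP : ∀ i ≤ m, ∀ j ≤ l, P i j ∈ Rc := by
    intro i hi j hj
    simp only [hRc, rect, Set.mem_ofPred_eq, P]
    omega
  have hH : ∀ i j, Adj (P i j) (P (i + 1) j) := fun i j =>
    adj_iff.2 (.inl ⟨by simp only [P]; push_cast; ring, rfl⟩)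
  have hV : ∀ i j, Adj (P i j) (P i (j + 1)) := fun i j =>
    adj_iff.2 (.inr (.inr (.inl ⟨rfl, by simp only [P]; push_cast; ring⟩)))
  have hDg : ∀ i j, Adj (P (i + 1) j) (P i (j + 1)) := fun i j =>
    adj_iff.2 (.inr (.inr (.inr (.inr (.inr
      ⟨by simp only [P]; push_cast; ring, by simp only [P]; push_cast; ring⟩)))))
  have key := sum_boundary_eq (fun i j => labelCross (lab (P i j)) (lab (P (i + 1) j)))
    (fun i j => labelCross (lab (P i j)) (lab (P i (j + 1)))) m l (by
      intro i hi j hj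
      have hA := hP i (by omega) j (by omega)
      have hB := hP (i + 1) (by omega) j (by omega)
      have hC := hP i (by omega) (j + 1) (by omega)
      have hD := hP (i + 1) (by omega) (j + 1) (by omega)
      have hAB := hcompat _ hA _ hB (hH _ _)
      have hAC := hcompat _ hA _ hC (hV _ _)
      have hBC := hcompat _ hB _ hC (hDg _ _)
      have hBD := hcompat _ hB _ hD (hV _ _)
      have hCD := hcompat _ hC _ hD (hH _ _)
      have h1 := labelCross_triangle _ _ _ hAB hBC hAC
      have h2 := labelCross_triangle _ _ _ hBC hCD hBD
      linarith)
  have hleft : ∀ j ≤ l, lab (P 0 j) ≠ 1 := by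
    intro j hj h
    obtain ⟨h1, h2⟩ := (lab1 _).1 h
    exact h2 ⟨P 0 j, by simp [P], Conn.refl ⟨hP 0 (by omega) j hj, h1⟩⟩
  have hright : ∀ j ≤ l, lab (P m j) ≠ 0 := by
    intro j hj h
    obtain ⟨h1, u, hu, hc⟩ := (lab0 _).1 h
    exact hLR u (P m j) hu (by simp only [P]; omega) hc
  have htop : ∀ i ≤ m, lab (P i l) ≠ 3 := by
    intro i hi h
    obtain ⟨h1, h2⟩ := (lab3 _).1 h
    exact h2 ⟨P i l, by simp only [P]; omega, Conn.refl ⟨hP i hi l le_rfl, h1⟩⟩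
  have hbot : ∀ i ≤ m, lab (P i 0) ≠ 2 := by
    intro i hi h
    obtain ⟨h1, u, hu, hc⟩ := (lab2 _).1 h
    exact hTB u (P i 0) hu (by simp [P]) hc
  have e1 : ∑ i ∈ Finset.range m, labelCross (lab (P i 0)) (lab (P (i + 1) 0)) = 0 := by
    refine Finset.sum_eq_zero fun i hi => ?_
    rw [Finset.mem_range] at hi
    have h1 := hbot i (by omega)
    have h2 := hbot (i + 1) (by omega)
    simp [labelCross, h1, h2]
  have e2 : ∑ j ∈ Finset.range l, labelCross (lab (P m j)) (lab (P m (j + 1))) = 0 := by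
    refine Finset.sum_eq_zero fun i hi => ?_
    rw [Finset.mem_range] at hi
    have h1 := hright i (by omega)
    have h2 := hright (i + 1) (by omega)
    simp [labelCross, h1, h2]
  have e3 : ∑ j ∈ Finset.range l, labelCross (lab (P 0 j)) (lab (P 0 (j + 1))) =
      (if lab (P 0 l) = 2 then 1 else 0) - (if lab (P 0 0) = 2 then 1 else 0) := by
    rw [← Finset.sum_range_sub (fun j => if lab (P 0 j) = 2 then (1 : ℤ) else 0)]
    refine Finset.sum_congr rfl fun j hj => ?_
    rw [Finset.mem_range] at hj
    have h1 := hleft j (by omega)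
    have h2 := hleft (j + 1) (by omega)
    have h3 := hcompat _ (hP 0 (by omega) j (by omega)) _ (hP 0 (by omega) (j + 1) (by omega))
      (hV _ _)
    revert h1 h2 h3
    generalize lab (P 0 j) = i
    generalize lab (P 0 (j + 1)) = j
    revert i j
    decide
  have e4 : ∑ i ∈ Finset.range m, labelCross (lab (P i l)) (lab (P (i + 1) l)) =
      (if lab (P m l) = 0 then 0 else 1) - (if lab (P 0 l) = 0 then 0 else 1) := by
    rw [← Finset.sum_range_sub (fun i => if lab (P i l) = 0 then (0 : ℤ) else 1)]
    refine Finset.sum_congr rfl fun i hi => ?_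
    rw [Finset.mem_range] at hi
    have h1 := htop i (by omega)
    have h2 := htop (i + 1) (by omega)
    have h3 := hcompat _ (hP i (by omega) l le_rfl) _ (hP (i + 1) (by omega) l le_rfl)
      (hH _ _)
    revert h1 h2 h3
    generalize lab (P i l) = i
    generalize lab (P (_ + 1) l) = j
    revert i j
    decide
  beta_reduce at key
  rw [e1, e2, e3, e4] at key
  have h1 := hleft l le_rfl
  have h2 := htop 0 (by omega)
  have h3 := hbot 0 (by omega)
  have h4 := hright l le_rfl
  rw [if_neg h3, if_neg h4] at key
  revert key h1 h2
  generalize lab (P 0 l) = i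
  revert i
  decide

/-- The event `E` is determined by the states of the sites of `Λ`. -/
def Dep (E : Set Config) (Λ : Finset Site) : Prop :=
  ∀ ω η : Config, (∀ v ∈ Λ, ω v = η v) → ω ∈ E → η ∈ E

/-- The configuration whose open sites are those of `S`. -/
def ind (S : Finset Site) : Config := fun v => decide (v ∈ S)

theorem ind_eq_true {S : Finset Site} {v : Site} : ind S v = true ↔ v ∈ S := by
  simp [ind]

namespace Dep

variable {E F : Set Config} {Λ Λ' : Finset Site}

theorem mono (h : Dep E Λ) (hΛ : Λ ⊆ Λ') : Dep E Λ' :=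
  fun ω ω' hω => h ω ω' fun v hv => hω v (hΛ hv)

theorem iff (h : Dep E Λ) {ω ω' : Config} (hω : ∀ v ∈ Λ, ω v = ω' v) : ω ∈ E ↔ ω' ∈ E :=
  ⟨h ω ω' hω, h ω' ω fun v hv => (hω v hv).symm⟩

theorem compl (h : Dep E Λ) : Dep Eᶜ Λ := fun ω ω' hω hE hE' =>
  hE (h ω' ω (fun v hv => (hω v hv).symm) hE')

theorem inter (h : Dep E Λ) (h' : Dep F Λ) : Dep (E ∩ F) Λ :=
  fun ω ω' hω hE => ⟨h ω ω' hω hE.1, h' ω ω' hω hE.2⟩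

theorem sdiff (h : Dep E Λ) (h' : Dep F Λ) : Dep (E \ F) Λ := h.inter h'.compl

end Dep

theorem measurableSet_cylinder (Λ : Finset Site) (f : Config) :
    MeasurableSet {ω : Config | ∀ v ∈ Λ, ω v = f v} := by
  have : {ω : Config | ∀ v ∈ Λ, ω v = f v} = ⋂ v ∈ Λ, (fun ω : Config => ω v) ⁻¹' {f v} := by
    ext ω
    simp
  rw [this]
  exact Finset.measurableSet_biInter _ fun v _ => measurable_pi_apply v (measurableSet_singleton _)

open Classical in
/-- The subsets of `Λ` belonging to a family. -/
noncomputable def fam (Λ : Finset Site) (A : Set (Finset Site)) : Finset (Finset Site) :=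
  Λ.powerset.filter (· ∈ A)

theorem mem_fam {Λ S : Finset Site} {A : Set (Finset Site)} : S ∈ fam Λ A ↔ S ⊆ Λ ∧ S ∈ A := by
  simp [fam]

theorem Dep.eq_biUnion {E : Set Config} {Λ : Finset Site} (h : Dep E Λ) :
    E = ⋃ S ∈ fam Λ (ind ⁻¹' E), {ω : Config | ∀ v ∈ Λ, ω v = ind S v} := by
  classical
  ext ω
  simp only [Set.mem_iUnion, mem_fam, Set.mem_preimage, Set.mem_ofPred_eq]
  constructor
  · intro hω
    have key : ∀ v ∈ Λ, ω v = ind (Λ.filter fun v => ω v = true) v := by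
      intro v hv
      rw [Bool.eq_iff_iff, ind_eq_true]
      simp [hv]
    exact ⟨_, ⟨Finset.filter_subset _ _, h _ _ key hω⟩, key⟩
  · rintro ⟨S, ⟨-, hS⟩, h1⟩
    exact (h.iff h1).2 hS

theorem Dep.measurableSet {E : Set Config} {Λ : Finset Site} (h : Dep E Λ) : MeasurableSet E := by
  rw [h.eq_biUnion]
  exact Finset.measurableSet_biUnion _ fun S _ => measurableSet_cylinder _ _

theorem measureReal_eq {μ : Measure Config} (hμ : IsBernoulliHalf μ) {E : Set Config}
    {Λ : Finset Site} (h : Dep E Λ) :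
    μ.real E = (fam Λ (ind ⁻¹' E)).card / 2 ^ Λ.card := by
  have := hμ.1
  conv_lhs => rw [h.eq_biUnion]
  rw [measureReal_biUnion_finset]
  · simp only [measureReal_def, hμ.2]
    simp [div_eq_mul_inv]
  · intro S hS S' hS' hne
    refine Set.disjoint_left.2 fun ω h1 h2 => hne ?_
    have hS1 := (mem_fam.1 hS).1
    have hS2 := (mem_fam.1 hS').1
    ext v
    rw [← ind_eq_true, ← ind_eq_true (S := S')]
    by_cases hv : v ∈ Λ
    · rw [← h1 v hv, ← h2 v hv]
    · have e1 : v ∉ S := fun h => hv (hS1 h)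
      have e2 : v ∉ S' := fun h => hv (hS2 h)
      simp [ind, e1, e2]
  · exact fun S _ => measurableSet_cylinder _ _

/-- Moving the sites by `e`, and exchanging open and closed if `b` holds. -/
def recolor (b : Bool) (e : Site ≃ Site) (ω : Config) : Config := fun v => xor b (ω (e v))

theorem measurable_recolor (b : Bool) (e : Site ≃ Site) : Measurable (recolor b e) :=
  measurable_pi_lambda _ fun v => (measurable_of_finite (fun x => xor b x)).comp
    (measurable_pi_apply (e v))

theorem IsBernoulliHalf.map {μ : Measure Config} (hμ : IsBernoulliHalf μ) (b : Bool)
    (e : Site ≃ Site) : IsBernoulliHalf (μ.map (recolor b e)) := by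
  have := hμ.1
  refine ⟨Measure.isProbabilityMeasure_map (measurable_recolor b e).aemeasurable, fun S f => ?_⟩
  rw [Measure.map_apply (measurable_recolor b e) (measurableSet_cylinder S f)]
  have := hμ.2 (S.map e.toEmbedding) (fun v => xor b (f (e.symm v)))
  rw [Finset.card_map] at this
  rw [← this]
  congr 1
  ext ω
  simp only [recolor, Set.mem_preimage, Set.mem_ofPred_eq, Finset.mem_map_equiv]
  constructor
  · intro h v hv
    have := h _ hv
    simp only [Equiv.apply_symm_apply] at this
    rw [← this]
    simp
  · intro h v hv
    have := h (e v) (by simpa using hv)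
    rw [this]
    simp

theorem measureReal_recolor {μ : Measure Config} (hμ : IsBernoulliHalf μ) {E : Set Config}
    {Λ : Finset Site} (h : Dep E Λ) (b : Bool) (e : Site ≃ Site) :
    μ.real (recolor b e ⁻¹' E) = μ.real E := by
  rw [measureReal_eq hμ h, ← measureReal_eq (hμ.map b e) h, measureReal_def, measureReal_def,
    Measure.map_apply (measurable_recolor b e) h.measurableSet]

theorem measureReal_le_of_injOn {μ : Measure Config} (hμ : IsBernoulliHalf μ) {A B : Set Config}
    {Λ : Finset Site} (hA : Dep A Λ) (hB : Dep B Λ) (Φ : Config → Config)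
    (hΦ : ∀ ω, ∀ v ∉ Λ, Φ ω v = ω v) (hAB : ∀ ω ∈ A, Φ ω ∈ B) (hinj : Set.InjOn Φ A) :
    μ.real A ≤ μ.real B := by
  classical
  rw [measureReal_eq hμ hA, measureReal_eq hμ hB]
  refine div_le_div_of_nonneg_right (Nat.cast_le.2 ?_) (by positivity)
  have key : ∀ S, ∀ v ∈ Λ, Φ (ind S) v = ind (Λ.filter fun v => Φ (ind S) v = true) v := by
    intro S v hv
    rw [Bool.eq_iff_iff, ind_eq_true]
    simp [hv]
  refine Finset.card_le_card_of_injOn (fun S => Λ.filter fun v => Φ (ind S) v = true) ?_ ?_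
  · intro S hS
    have hS := mem_fam.1 hS
    exact mem_fam.2 ⟨Finset.filter_subset _ _, hB _ _ (key S) (hAB _ hS.2)⟩
  · intro S hS S' hS' heq
    have hS := mem_fam.1 hS
    have hS' := mem_fam.1 hS'
    have : ind S = ind S' := by
      refine hinj hS.2 hS'.2 ?_
      funext v
      by_cases hv : v ∈ Λ
      · rw [key S v hv, key S' v hv]
        exact congrArg (fun T => ind T v) heq
      · rw [hΦ _ _ hv, hΦ _ _ hv]
        have e1 : v ∉ S := fun h => hv (hS.1 h)
        have e2 : v ∉ S' := fun h => hv (hS'.1 h)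
        simp [ind, e1, e2]
    ext v
    rw [← ind_eq_true, this, ind_eq_true]

theorem card_fam_insert {Λ : Finset Site} {a : Site} (ha : a ∉ Λ) (A : Set (Finset Site)) :
    (fam (insert a Λ) A).card = (fam Λ A).card + (fam Λ {S | insert a S ∈ A}).card := by
  classical
  simp only [fam, Finset.card_filter]
  rw [Finset.sum_powerset_insert ha]
  rfl

theorem fam_mono (Λ : Finset Site) {A B : Set (Finset Site)} (h : ∀ S ⊆ Λ, S ∈ A → S ∈ B) :
    fam Λ A ⊆ fam Λ B := fun S hS => by
  rw [mem_fam] at *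
  exact ⟨hS.1, h S hS.1 hS.2⟩

theorem card_fam_mul_le (Λ : Finset Site) : ∀ {A B : Set (Finset Site)}, IsUpperSet A →
    IsUpperSet B → (fam Λ A).card * (fam Λ B).card ≤ 2 ^ Λ.card * (fam Λ (A ∩ B)).card := by
  classical
  induction Λ using Finset.induction_on with
  | empty =>
    intro A B _ _
    simp only [fam, Finset.powerset_empty, Finset.card_filter, Finset.sum_singleton,
      Finset.card_empty, pow_zero, one_mul, Set.mem_inter_iff]
    split_ifs <;> simp_all
  | insert a Λ ha ih =>
    intro A B hA hB
    have hA' : IsUpperSet {S | insert a S ∈ A} := fun S T hST h =>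
      hA (Finset.insert_subset_insert a hST) h
    have hB' : IsUpperSet {S | insert a S ∈ B} := fun S T hST h =>
      hB (Finset.insert_subset_insert a hST) h
    rw [card_fam_insert ha, card_fam_insert ha, card_fam_insert ha, Finset.card_insert_of_notMem ha]
    have i0 := ih hA hB
    have i1 := ih hA' hB'
    have e : {S | insert a S ∈ A ∩ B} = {S | insert a S ∈ A} ∩ {S | insert a S ∈ B} := rfl
    rw [e]
    have mA := Finset.card_le_card
      (fam_mono Λ (A := A) (B := {S | insert a S ∈ A}) fun S _ h => hA (Finset.subset_insert a S) h)
    have mB := Finset.card_le_card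
      (fam_mono Λ (A := B) (B := {S | insert a S ∈ B}) fun S _ h => hB (Finset.subset_insert a S) h)
    rw [pow_succ]
    zify at *
    nlinarith [mul_nonneg (sub_nonneg.2 mA) (sub_nonneg.2 mB)]

/-- Disjoint occurrence of two families. -/
def famBox (A B : Set (Finset Site)) : Set (Finset Site) :=
  {S | ∃ U ∈ A, ∃ V ∈ B, U ⊆ S ∧ V ⊆ S ∧ Disjoint U V}

theorem card_famBox_le (Λ : Finset Site) : ∀ {A B : Set (Finset Site)}, IsUpperSet A →
    IsUpperSet B → (fam Λ (famBox A B)).card * 2 ^ Λ.card ≤ (fam Λ A).card * (fam Λ B).card := by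
  classical
  induction Λ using Finset.induction_on with
  | empty =>
    intro A B hA hB
    simp only [fam, Finset.powerset_empty, Finset.card_filter, Finset.sum_singleton,
      Finset.card_empty, pow_zero, mul_one]
    by_cases h : ∅ ∈ famBox A B
    · obtain ⟨U, hU, V, hV, h1, h2, -⟩ := h
      have e1 := hA h1 hU
      have e2 := hB h2 hV
      rw [if_pos e1, if_pos e2]
      split_ifs <;> simp
    · rw [if_neg h]
      simp
  | insert a Λ ha ih =>
    intro A B hA hB
    have hA' : IsUpperSet {S | insert a S ∈ A} := fun S T hST h =>
      hA (Finset.insert_subset_insert a hST) h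
    have hB' : IsUpperSet {S | insert a S ∈ B} := fun S T hST h =>
      hB (Finset.insert_subset_insert a hST) h
    have mAB : A ⊆ {S | insert a S ∈ A} := fun S h => hA (Finset.subset_insert a S) h
    have mBB : B ⊆ {S | insert a S ∈ B} := fun S h => hB (Finset.subset_insert a S) h
    have mA := Finset.card_le_card (fam_mono Λ fun S _ h => mAB h)
    have mB := Finset.card_le_card (fam_mono Λ fun S _ h => mBB h)
    rw [card_fam_insert ha, card_fam_insert ha, card_fam_insert ha, Finset.card_insert_of_notMem ha]
    have i1 := ih hA' hB
    have i2 := ih hA hB'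
    set X := famBox {S | insert a S ∈ A} B
    set Y := famBox A {S | insert a S ∈ B}
    have hsub : fam Λ {S | insert a S ∈ famBox A B} ⊆ fam Λ X ∪ fam Λ Y := by
      intro S hS
      rw [Finset.mem_union, mem_fam, mem_fam]
      rw [mem_fam] at hS
      obtain ⟨hSΛ, U, hU, V, hV, h1, h2, h3⟩ := hS
      have haS : a ∉ S := fun h => ha (hSΛ h)
      by_cases haV : a ∈ V
      · have haU : a ∉ U := fun h => Finset.disjoint_left.1 h3 h haV
        refine .inr ⟨hSΛ, U, hU, V.erase a, ?_, ?_, ?_, ?_⟩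
        · simpa [Finset.insert_erase haV] using hV
        · exact (Finset.subset_insert_iff_of_notMem haU).1 h1
        · exact Finset.subset_insert_iff.1 h2
        · exact h3.mono_right (Finset.erase_subset _ _)
      · refine .inl ⟨hSΛ, U.erase a, ?_, V, hV, ?_, ?_, ?_⟩
        · exact hA (fun v hv => by
            by_cases e : v = a
            · simp [e]
            · simp [e, hv]) hU
        · exact Finset.subset_insert_iff.1 h1
        · exact (Finset.subset_insert_iff_of_notMem haV).1 h2
        · exact h3.mono_left (Finset.erase_subset _ _)
    have hsub0 : fam Λ (famBox A B) ⊆ fam Λ X ∩ fam Λ Y := by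
      intro S hS
      rw [Finset.mem_inter, mem_fam, mem_fam]
      rw [mem_fam] at hS
      obtain ⟨hSΛ, U, hU, V, hV, h⟩ := hS
      exact ⟨⟨hSΛ, U, mAB hU, V, hV, h⟩, hSΛ, U, hU, V, mBB hV, h⟩
    have c1 := Finset.card_le_card hsub
    have c0 := Finset.card_le_card hsub0
    have c2 := Finset.card_union_add_card_inter (fam Λ X) (fam Λ Y)
    have c3 : (fam Λ (famBox A B)).card + (fam Λ {S | insert a S ∈ famBox A B}).card ≤
      (fam Λ X).card + (fam Λ Y).card := by omega
    have c4 := Nat.mul_le_mul_right (2 ^ (Λ.card + 1)) c3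
    refine c4.trans ?_
    rw [pow_succ]
    clear c4 c3 c2 c1 c0 hsub hsub0
    zify at *
    nlinarith [mul_nonneg (sub_nonneg.2 mA) (sub_nonneg.2 mB)]

/-- Disjoint occurrence of two increasing events. -/
def Box (A B : Set Config) : Set Config :=
  {ω | ∃ α ∈ A, ∃ β ∈ B, α ≤ ω ∧ β ≤ ω ∧ ∀ v, ¬ (α v = true ∧ β v = true)}

theorem Bool.le_iff_true {a b : Bool} : a ≤ b ↔ (a = true → b = true) := by
  revert a b
  decide

theorem isUpperSet_ind {A : Set Config} (hA : IsUpperSet A) : IsUpperSet (ind ⁻¹' A) := by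
  intro S T hST h
  refine hA (fun v => ?_) h
  rw [Bool.le_iff_true, ind_eq_true, ind_eq_true]
  exact fun hv => hST hv

theorem ind_preimage_box (A B : Set Config) :
    ind ⁻¹' Box A B = famBox (ind ⁻¹' A) (ind ⁻¹' B) := by
  classical
  have aux : ∀ (S : Finset Site) (α : Config), α ≤ ind S → ∃ U ⊆ S, ind U = α := by
    intro S α h
    refine ⟨S.filter fun v => α v = true, Finset.filter_subset _ _, ?_⟩
    funext v
    rw [Bool.eq_iff_iff, ind_eq_true, Finset.mem_filter, and_iff_right_iff_imp]
    intro hv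
    exact ind_eq_true.1 (Bool.le_iff_true.1 (h v) hv)
  ext S
  constructor
  · rintro ⟨α, hα, β, hβ, h1, h2, h3⟩
    obtain ⟨U, hU, rfl⟩ := aux S α h1
    obtain ⟨V, hV, rfl⟩ := aux S β h2
    refine ⟨U, hα, V, hβ, hU, hV, Finset.disjoint_left.2 fun v hu hv => h3 v ?_⟩
    exact ⟨ind_eq_true.2 hu, ind_eq_true.2 hv⟩
  · rintro ⟨U, hα, V, hβ, h1, h2, h3⟩
    refine ⟨ind U, hα, ind V, hβ, fun v => ?_, fun v => ?_, fun v hv => ?_⟩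
    · rw [Bool.le_iff_true, ind_eq_true, ind_eq_true]
      exact fun h => h1 h
    · rw [Bool.le_iff_true, ind_eq_true, ind_eq_true]
      exact fun h => h2 h
    · rw [ind_eq_true, ind_eq_true] at hv
      exact Finset.disjoint_left.1 h3 hv.1 hv.2

theorem Dep.box {A B : Set Config} {Λ : Finset Site} (hA : Dep A Λ) (hB : Dep B Λ) :
    Dep (Box A B) Λ := by
  classical
  rintro ω ω' hω ⟨α, hα, β, hβ, h1, h2, h3⟩
  refine ⟨fun v => decide (v ∈ Λ) && α v, hA _ _ (fun v hv => by simp [hv]) hα,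
    fun v => decide (v ∈ Λ) && β v, hB _ _ (fun v hv => by simp [hv]) hβ, fun v => ?_,
    fun v => ?_, fun v hv => h3 v ?_⟩
  · rw [Bool.le_iff_true, Bool.and_eq_true, decide_eq_true_iff]
    rintro ⟨hv, h⟩
    rw [← hω v hv]
    exact Bool.le_iff_true.1 (h1 v) h
  · rw [Bool.le_iff_true, Bool.and_eq_true, decide_eq_true_iff]
    rintro ⟨hv, h⟩
    rw [← hω v hv]
    exact Bool.le_iff_true.1 (h2 v) h
  · simp only [Bool.and_eq_true] at hv
    exact ⟨hv.1.2, hv.2.2⟩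

theorem isUpperSet_box (A B : Set Config) : IsUpperSet (Box A B) := by
  rintro ω ω' hω ⟨α, hα, β, hβ, h1, h2, h3⟩
  exact ⟨α, hα, β, hβ, h1.trans hω, h2.trans hω, h3⟩

/-- The van den Berg–Kesten inequality for increasing events. -/
theorem measureReal_box_le {μ : Measure Config} (hμ : IsBernoulliHalf μ) {A B : Set Config}
    {Λ : Finset Site} (hA : Dep A Λ) (hB : Dep B Λ) (uA : IsUpperSet A) (uB : IsUpperSet B) :
    μ.real (Box A B) ≤ μ.real A * μ.real B := by
  rw [measureReal_eq hμ hA, measureReal_eq hμ hB, measureReal_eq hμ (hA.box hB),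
    ind_preimage_box, div_mul_div_comm, div_le_div_iff₀ (by positivity) (by positivity)]
  have := card_famBox_le Λ (isUpperSet_ind uA) (isUpperSet_ind uB)
  have h : ((fam Λ (famBox (ind ⁻¹' A) (ind ⁻¹' B))).card : ℝ) * 2 ^ Λ.card ≤
      (fam Λ (ind ⁻¹' A)).card * (fam Λ (ind ⁻¹' B)).card := by exact_mod_cast this
  rw [← mul_assoc]
  gcongr

/-- The Harris–FKG inequality for increasing events. -/
theorem le_measureReal_inter {μ : Measure Config} (hμ : IsBernoulliHalf μ) {A B : Set Config}
    {Λ : Finset Site} (hA : Dep A Λ) (hB : Dep B Λ) (uA : IsUpperSet A) (uB : IsUpperSet B) :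
    μ.real A * μ.real B ≤ μ.real (A ∩ B) := by
  rw [measureReal_eq hμ hA, measureReal_eq hμ hB, measureReal_eq hμ (hA.inter hB),
    div_mul_div_comm, div_le_div_iff₀ (by positivity) (by positivity)]
  have := card_fam_mul_le Λ (isUpperSet_ind uA) (isUpperSet_ind uB)
  have h : ((fam Λ (ind ⁻¹' A)).card : ℝ) * (fam Λ (ind ⁻¹' B)).card ≤
      2 ^ Λ.card * (fam Λ (ind ⁻¹' (A ∩ B))).card := by exact_mod_cast this
  calc _ ≤ 2 ^ Λ.card * ((fam Λ (ind ⁻¹' (A ∩ B))).card : ℝ) * 2 ^ Λ.card := by gcongr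
    _ = _ := by ring

/-- The set of open sites of a configuration. -/
def openSet (ω : Config) : Set Site := {v | ω v = true}

/-- The event that `A` and `B` are joined by an open walk inside `S`. -/
def Ev (S A B : Set Site) : Set Config :=
  {ω | ∃ u ∈ A, ∃ v ∈ B, Conn (S ∩ openSet ω) u v}

theorem isUpperSet_Ev (S A B : Set Site) : IsUpperSet (Ev S A B) := by
  rintro ω ω' hω ⟨u, hu, v, hv, h⟩
  exact ⟨u, hu, v, hv, h.mono fun x hx => ⟨hx.1, Bool.le_iff_true.1 (hω x) hx.2⟩⟩

theorem dep_Ev {S : Set Site} {Λ : Finset Site} (h : S ⊆ Λ) (A B : Set Site) :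
    Dep (Ev S A B) Λ := by
  rintro ω ω' hω ⟨u, hu, v, hv, hc⟩
  refine ⟨u, hu, v, hv, hc.mono fun x hx => ⟨hx.1, ?_⟩⟩
  have : ω x = true := hx.2
  rw [hω x (h hx.1)] at this
  exact this

theorem Ev_mono {S S' A A' B B' : Set Site} (hS : S ⊆ S') (hA : A ⊆ A') (hB : B ⊆ B') :
    Ev S A B ⊆ Ev S' A' B' := by
  rintro ω ⟨u, hu, v, hv, hc⟩
  exact ⟨u, hA hu, v, hB hv, hc.mono (Set.inter_subset_inter_left _ hS)⟩

theorem Ev_symm (S A B : Set Site) : Ev S A B = Ev S B A := by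
  ext ω
  constructor <;> rintro ⟨u, hu, v, hv, hc⟩ <;> exact ⟨v, hv, u, hu, hc.symm⟩

theorem mem_rect {x₀ x₁ y₀ y₁ : ℤ} {v : Site} :
    v ∈ rect x₀ x₁ y₀ y₁ ↔ x₀ ≤ v.1 ∧ v.1 ≤ x₁ ∧ y₀ ≤ v.2 ∧ v.2 ≤ y₁ := Iff.rfl

theorem mem_openSet {ω : Config} {v : Site} : v ∈ openSet ω ↔ ω v = true := Iff.rfl

theorem Conn.map {S S' : Set Site} (e : Site → Site) (he : ∀ a b, Adj a b → Adj (e a) (e b))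
    (hS : ∀ v ∈ S, e v ∈ S') {u v : Site} (h : Conn S u v) : Conn S' (e u) (e v) := by
  obtain ⟨hu, h⟩ := h
  induction h with
  | refl => exact Conn.refl (hS _ hu)
  | tail _ h2 ih => exact ih.tail (he _ _ h2.1) (hS _ h2.2)

theorem Conn.hline {S : Set Site} {a b y : ℤ} (hab : a ≤ b)
    (h : ∀ i, a ≤ i → i ≤ b → (i, y) ∈ S) : Conn S (a, y) (b, y) := by
  induction b, hab using Int.leInduction with
  | base => exact Conn.refl (h a le_rfl le_rfl)
  | succ b hab ih =>
    refine (ih fun i h1 h2 => h i h1 (by omega)).tail ?_ (h _ (by omega) le_rfl)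
    exact adj_iff.2 (.inl ⟨rfl, rfl⟩)

theorem Conn.vline {S : Set Site} {x a b : ℤ} (hab : a ≤ b)
    (h : ∀ i, a ≤ i → i ≤ b → (x, i) ∈ S) : Conn S (x, a) (x, b) := by
  induction b, hab using Int.leInduction with
  | base => exact Conn.refl (h a le_rfl le_rfl)
  | succ b hab ih =>
    refine (ih fun i h1 h2 => h i h1 (by omega)).tail ?_ (h _ (by omega) le_rfl)
    exact adj_iff.2 (.inr (.inr (.inl ⟨rfl, rfl⟩)))

/-- The sites of a rectangle as a finite set. -/
noncomputable def rectFinset (x₀ x₁ y₀ y₁ : ℤ) : Finset Site := Finset.Icc x₀ x₁ ×ˢ Finset.Icc y₀ y₁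

theorem mem_rectFinset {x₀ x₁ y₀ y₁ : ℤ} {v : Site} :
    v ∈ rectFinset x₀ x₁ y₀ y₁ ↔ v ∈ rect x₀ x₁ y₀ y₁ := by
  simp [rectFinset, mem_rect, and_assoc]

theorem subset_rectFinset {S : Set Site} {x₀ x₁ y₀ y₁ : ℤ} (h : S ⊆ rect x₀ x₁ y₀ y₁) :
    S ⊆ (rectFinset x₀ x₁ y₀ y₁ : Set Site) := fun _ hv =>
  Finset.mem_coe.2 (mem_rectFinset.2 (h hv))

theorem measureReal_Ev_le {μ : Measure Config} (hμ : IsBernoulliHalf μ) {S A B S' A' B' : Set Site}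
    {Λ : Finset Site} (hΛ : S ⊆ Λ) (e : Site ≃ Site) (he : ∀ a b, Adj a b → Adj (e a) (e b))
    (hS : ∀ v ∈ S, e v ∈ S') (hA : ∀ v ∈ S, v ∈ A → e v ∈ A') (hB : ∀ v ∈ S, v ∈ B → e v ∈ B') :
    μ.real (Ev S A B) ≤ μ.real (Ev S' A' B') := by
  have := hμ.1
  rw [← measureReal_recolor hμ (dep_Ev hΛ A B) false e]
  refine measureReal_mono ?_
  rintro ω ⟨u, hu, v, hv, h⟩
  refine ⟨e u, hA _ h.left_mem.1 hu, e v, hB _ h.right_mem.1 hv, h.map e he ?_⟩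
  rintro x ⟨h1, h2⟩
  refine ⟨hS x h1, ?_⟩
  simpa [recolor, openSet] using h2

/-- The event that a rectangle has a left-right open walk. -/
noncomputable def HEv (x₀ x₁ y₀ y₁ : ℤ) : Set Config := Ev (rect x₀ x₁ y₀ y₁) {v | v.1 = x₀} {v | v.1 = x₁}

/-- The event that a rectangle has a top-bottom open walk. -/
noncomputable def VEv (x₀ x₁ y₀ y₁ : ℤ) : Set Config := Ev (rect x₀ x₁ y₀ y₁) {v | v.2 = y₁} {v | v.2 = y₀}

/-- The configuration with open and closed exchanged. -/
noncomputable def negate (ω : Config) : Config := recolor true (Equiv.refl Site) ω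

theorem negate_apply (ω : Config) (v : Site) : negate ω v = !ω v := by
  simp [negate, recolor]

theorem openSet_negate (ω : Config) : openSet (negate ω) = (openSet ω)ᶜ := by
  ext v
  simp [openSet, negate_apply]

section Rectangles

variable {x₀ x₁ y₀ y₁ : ℤ} {μ : Measure Config} (hμ : IsBernoulliHalf μ)

theorem dep_HEv : Dep (HEv x₀ x₁ y₀ y₁) (rectFinset x₀ x₁ y₀ y₁) :=
  dep_Ev (subset_rectFinset subset_rfl) _ _

theorem dep_VEv : Dep (VEv x₀ x₁ y₀ y₁) (rectFinset x₀ x₁ y₀ y₁) :=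
  dep_Ev (subset_rectFinset subset_rfl) _ _

theorem HEv_mono {y₀' y₁' : ℤ} (h0 : y₀' ≤ y₀) (h1 : y₁ ≤ y₁') :
    HEv x₀ x₁ y₀ y₁ ⊆ HEv x₀ x₁ y₀' y₁' :=
  Ev_mono (fun v hv => by rw [mem_rect] at *; omega) subset_rfl subset_rfl

theorem negate_mem_VEv_iff (hx : x₀ ≤ x₁) (hy : y₀ ≤ y₁) (ω : Config) :
    negate ω ∈ VEv x₀ x₁ y₀ y₁ ↔ ω ∉ HEv x₀ x₁ y₀ y₁ := by
  constructor
  · rintro ⟨t, ht, b, hb, h1⟩ ⟨u, hu, v, hv, h2⟩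
    obtain ⟨w, hw1, hw2⟩ := crossings_meet (Set.inter_subset_left) (Set.inter_subset_left)
      h2 h1 hu hv ht hb
    have := hw2.2
    rw [openSet_negate] at this
    exact this hw1.2
  · intro h
    rcases hex hx hy (openSet ω) with ⟨u, v, hu, hv, h'⟩ | ⟨t, b, ht, hb, h'⟩
    · exact absurd ⟨u, hu, v, hv, h'⟩ h
    · refine ⟨t, ht, b, hb, ?_⟩
      rwa [openSet_negate, ← Set.sdiff_eq]

include hμ

theorem measureReal_negate {E : Set Config} {Λ : Finset Site} (h : Dep E Λ) :
    μ.real (negate ⁻¹' E) = μ.real E := measureReal_recolor hμ h true (Equiv.refl Site)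

theorem measureReal_VEv (hx : x₀ ≤ x₁) (hy : y₀ ≤ y₁) :
    μ.real (VEv x₀ x₁ y₀ y₁) = 1 - μ.real (HEv x₀ x₁ y₀ y₁) := by
  have := hμ.1
  rw [← measureReal_negate hμ dep_VEv, ← probReal_compl_eq_one_sub dep_HEv.measurableSet]
  congr 1
  ext ω
  exact negate_mem_VEv_iff hx hy ω

theorem measureReal_HEv_le_translate (a b : ℤ) :
    μ.real (HEv x₀ x₁ y₀ y₁) ≤ μ.real (HEv (x₀ + a) (x₁ + a) (y₀ + b) (y₁ + b)) := by
  refine measureReal_Ev_le hμ (subset_rectFinset subset_rfl) (Equiv.addRight ((a, b) : Site))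
    ?_ ?_ ?_ ?_
  · intro u v h
    rw [adj_iff] at *
    simp only [Equiv.coe_addRight, Prod.fst_add, Prod.snd_add]
    omega
  · intro v hv
    rw [mem_rect] at *
    simp only [Equiv.coe_addRight, Prod.fst_add, Prod.snd_add]
    omega
  · rintro v - hv
    simpa using hv
  · rintro v - hv
    simpa using hv

theorem measureReal_HEv_translate (a b : ℤ) :
    μ.real (HEv (x₀ + a) (x₁ + a) (y₀ + b) (y₁ + b)) = μ.real (HEv x₀ x₁ y₀ y₁) := by
  refine le_antisymm ?_ (measureReal_HEv_le_translate hμ a b)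
  have := measureReal_HEv_le_translate (x₀ := x₀ + a) (x₁ := x₁ + a) (y₀ := y₀ + b)
    (y₁ := y₁ + b) hμ (-a) (-b)
  simpa using this

theorem measureReal_VEv_le_swap : μ.real (VEv x₀ x₁ y₀ y₁) ≤ μ.real (HEv y₀ y₁ x₀ x₁) := by
  rw [HEv, Ev_symm]
  refine measureReal_Ev_le hμ (subset_rectFinset subset_rfl) (Equiv.prodComm ℤ ℤ) ?_ ?_ ?_ ?_
  · intro u v h
    rw [adj_iff] at *
    simp only [Equiv.prodComm_apply, Prod.fst_swap, Prod.snd_swap]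
    omega
  · intro v hv
    rw [mem_rect] at *
    simp only [Equiv.prodComm_apply, Prod.fst_swap, Prod.snd_swap]
    omega
  · rintro v - hv
    simpa using hv
  · rintro v - hv
    simpa using hv

theorem measureReal_HEv_le_swap : μ.real (HEv x₀ x₁ y₀ y₁) ≤ μ.real (VEv y₀ y₁ x₀ x₁) := by
  rw [HEv, Ev_symm]
  refine measureReal_Ev_le hμ (subset_rectFinset subset_rfl) (Equiv.prodComm ℤ ℤ) ?_ ?_ ?_ ?_
  · intro u v h
    rw [adj_iff] at *
    simp only [Equiv.prodComm_apply, Prod.fst_swap, Prod.snd_swap]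
    omega
  · intro v hv
    rw [mem_rect] at *
    simp only [Equiv.prodComm_apply, Prod.fst_swap, Prod.snd_swap]
    omega
  · rintro v - hv
    simpa using hv
  · rintro v - hv
    simpa using hv

theorem measureReal_HEv_square (hx : x₀ ≤ x₁) : μ.real (HEv x₀ x₁ x₀ x₁) = 1 / 2 := by
  have h1 := measureReal_VEv hμ hx hx
  have h2 := measureReal_VEv_le_swap (x₀ := x₀) (x₁ := x₁) (y₀ := x₀) (y₁ := x₁) hμ
  have h3 := measureReal_HEv_le_swap (x₀ := x₀) (x₁ := x₁) (y₀ := x₀) (y₁ := x₁) hμ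
  linarith

end Rectangles

/-- `p` contains a walk from `L` to `R`. -/
def Crosses (p L R : Set Site) : Prop := ∃ u ∈ L, ∃ v ∈ R, Conn p u v

theorem Crosses.mono {p p' L R : Set Site} (h : Crosses p L R) (hp : p ⊆ p') : Crosses p' L R := by
  obtain ⟨u, hu, v, hv, h⟩ := h
  exact ⟨u, hu, v, hv, h.mono hp⟩

/-- A region with four sides satisfying the planar crossing duality. -/
structure IsQuad (Q L R T B : Set Site) : Prop where
  crosses_or : ∀ C, Crosses (Q ∩ C) L R ∨ Crosses (Q \ C) T B
  meet : ∀ p ⊆ Q, ∀ s ⊆ Q, Crosses p L R → Crosses s T B → (p ∩ s).Nonempty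

/-- The sites of `Q` strictly below `q`: those joined to `B` avoiding `q`. -/
def below (Q B q : Set Site) : Set Site := {v | ∃ w ∈ B, Conn (Q \ q) v w}

/-- The sites of `Q` strictly below some crossing contained in `C`. -/
def Low (Q L R B C : Set Site) : Set Site :=
  {v | ∃ q ⊆ Q ∩ C, Crosses q L R ∧ v ∈ below Q B q}

theorem Low_subset {Q L R B C : Set Site} : Low Q L R B C ⊆ Q := by
  rintro v ⟨q, -, -, w, -, h⟩
  exact h.left_mem.1

namespace IsQuad

variable {Q L R T B C C' p : Set Site} (hQ : IsQuad Q L R T B)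
include hQ

theorem top_notMem_Low {t : Site} (ht : t ∈ T) : t ∉ Low Q L R B C := by
  rintro ⟨q, hq, hc, w, hw, h⟩
  obtain ⟨x, hx1, hx2⟩ := hQ.meet q (hq.trans Set.inter_subset_left) (Q \ q) Set.sdiff_subset hc
    ⟨t, ht, w, hw, h⟩
  exact hx2.2 hx1

theorem crosses_diff_Low (hC : Crosses (Q ∩ C) L R) :
    Crosses ((Q ∩ C) \ Low Q L R B C) L R := by
  rcases hQ.crosses_or (C \ Low Q L R B C) with h | ⟨t, ht, b, hb, h⟩
  · refine h.mono fun v hv => ⟨⟨hv.1, hv.2.1⟩, hv.2.2⟩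
  · exfalso
    refine hQ.top_notMem_Low (C := C) ht ?_
    have hmem : ∀ v, v ∈ Q \ (C \ Low Q L R B C) → v ∉ Low Q L R B C → v ∉ C :=
      fun v hv h1 h2 => hv.2 ⟨h2, h1⟩
    refine h.head_induct (P := fun v => v ∈ Low Q L R B C) ?_ ?_
    · intro hbm
      by_contra hlow
      refine hlow ⟨Q ∩ C, subset_rfl, hC, b, hb, Conn.refl ⟨hbm.1, fun h => ?_⟩⟩
      exact hmem b hbm hlow h.2
    · rintro x y hx hxy - ⟨q, hq, hc, w, hw, hy⟩
      by_contra hlow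
      refine hlow ⟨q, hq, hc, w, hw, hy.head ⟨hx.1, fun h => ?_⟩ hxy⟩
      exact hmem x hx hlow (hq h).2

omit hQ in
theorem below_eq_Low (hp : p ⊆ (Q ∩ C) \ Low Q L R B C) (hc : Crosses p L R) :
    below Q B p = Low Q L R B C := by
  refine Set.Subset.antisymm (fun v hv => ⟨p, fun x hx => (hp hx).1, hc, hv⟩) ?_
  rintro v ⟨q, hq, hqc, w, hw, h⟩
  refine ⟨w, hw, ?_⟩
  have := h.symm.component
  refine (Conn.mono (S' := Q \ p) (fun x hx => ?_) this).symm
  exact ⟨hx.right_mem.1, fun hxp => (hp hxp).2 ⟨q, hq, hqc, w, hw, Conn.symm hx⟩⟩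

omit hQ in
theorem mem_of_adj_Low (hp : p ⊆ (Q ∩ C) \ Low Q L R B C) (hc : Crosses p L R) {v k : Site}
    (hv : v ∈ Low Q L R B C) (hk : k ∈ Q) (hk' : k ∉ Low Q L R B C) (hkv : Adj k v) : k ∈ p := by
  by_contra hkp
  rw [← below_eq_Low hp hc] at hv hk'
  obtain ⟨w, hw, h⟩ := hv
  exact hk' ⟨w, hw, h.head ⟨hk, hkp⟩ hkv⟩

omit hQ in
theorem mem_of_mem_bot (hp : p ⊆ (Q ∩ C) \ Low Q L R B C) (hc : Crosses p L R) {k : Site}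
    (hk : k ∈ Q) (hkB : k ∈ B) (hk' : k ∉ Low Q L R B C) : k ∈ p := by
  by_contra hkp
  rw [← below_eq_Low hp hc] at hk'
  exact hk' ⟨k, hkB, Conn.refl ⟨hk, hkp⟩⟩

theorem Low_congr (hC : Crosses (Q ∩ C) L R)
    (h : ∀ v ∈ Q, v ∉ Low Q L R B C → (v ∈ C ↔ v ∈ C')) :
    Crosses (Q ∩ C') L R ∧ Low Q L R B C' = Low Q L R B C := by
  have h1 := hQ.crosses_diff_Low (B := B) hC
  have hsub : (Q ∩ C) \ Low Q L R B C ⊆ Q ∩ C' :=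
    fun v hv => ⟨hv.1.1, (h v hv.1.1 hv.2).1 hv.1.2⟩
  have hC' : Crosses (Q ∩ C') L R := h1.mono hsub
  have hle : Low Q L R B C ⊆ Low Q L R B C' := by
    rw [← below_eq_Low subset_rfl h1]
    exact fun v hv => ⟨_, hsub, h1, hv⟩
  refine ⟨hC', Set.Subset.antisymm ?_ hle⟩
  have h2 := hQ.crosses_diff_Low (B := B) hC'
  intro v hv
  rw [← below_eq_Low subset_rfl h2] at hv
  refine ⟨_, fun x hx => ?_, h2, hv⟩
  exact ⟨hx.1.1, (h x hx.1.1 fun h' => hx.2 (hle h')).2 hx.1.2⟩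

end IsQuad

theorem isQuad_rect {x₀ x₁ y₀ y₁ : ℤ} (hx : x₀ ≤ x₁) (hy : y₀ ≤ y₁) :
    IsQuad (rect x₀ x₁ y₀ y₁) {v | v.1 = x₀} {v | v.1 = x₁} {v | v.2 = y₁} {v | v.2 = y₀} where
  crosses_or C := by
    rcases hex hx hy C with ⟨u, v, hu, hv, h⟩ | ⟨t, b, ht, hb, h⟩
    · exact .inl ⟨u, hu, v, hv, h⟩
    · exact .inr ⟨t, ht, b, hb, h⟩
  meet p hp s hs := by
    rintro ⟨u, hu, v, hv, h⟩ ⟨t, ht, b, hb, h'⟩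
    exact crossings_meet hp hs h h' hu hv ht hb

/-- The half of the trapezoid `trap R b` to the left of its axis. -/
def halfTrap (R b : ℤ) : Set Site := {v | 0 ≤ v.1 ∧ 0 ≤ v.2 ∧ v.2 ≤ b ∧ 2 * v.1 + v.2 ≤ R}

/-- A trapezoid of height `b` and lower side of length `R`. -/
def trap (R b : ℤ) : Set Site := {v | 0 ≤ v.1 ∧ 0 ≤ v.2 ∧ v.2 ≤ b ∧ v.1 + v.2 ≤ R}

/-- The sites at the axis of the trapezoid. -/
def nearAxis (R : ℤ) : Set Site := {v | R - 1 ≤ 2 * v.1 + v.2}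

/-- The vertical line at the origin. -/
def leftLine : Set Site := {v | v.1 = 0}

/-- The horizontal line at the origin. -/
def botLine : Set Site := {v | v.2 = 0}

/-- The right side of the trapezoid. -/
def diagLine (R : ℤ) : Set Site := {v | v.1 + v.2 = R}

/-- The right side of the trapezoid and the right half of its lower side. -/
def rightArc (R : ℤ) : Set Site := {v | v.1 + v.2 = R ∨ (v.2 = 0 ∧ R - 1 ≤ 2 * v.1)}

/-- The left side of the trapezoid and the left half of its lower side. -/
def leftArc (R : ℤ) : Set Site := {v | v.1 = 0 ∨ (v.2 = 0 ∧ 2 * v.1 ≤ R + 1)}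

/-- The reflection of the trapezoid. -/
def mirror (R : ℤ) : Site ≃ Site where
  toFun v := (R - v.1 - v.2, v.2)
  invFun v := (R - v.1 - v.2, v.2)
  left_inv v := Prod.ext (by dsimp only; ring) rfl
  right_inv v := Prod.ext (by dsimp only; ring) rfl

theorem mem_halfTrap {R b : ℤ} {v : Site} :
    v ∈ halfTrap R b ↔ 0 ≤ v.1 ∧ 0 ≤ v.2 ∧ v.2 ≤ b ∧ 2 * v.1 + v.2 ≤ R := Iff.rfl

theorem mem_trap {R b : ℤ} {v : Site} :
    v ∈ trap R b ↔ 0 ≤ v.1 ∧ 0 ≤ v.2 ∧ v.2 ≤ b ∧ v.1 + v.2 ≤ R := Iff.rfl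

theorem mem_nearAxis {R : ℤ} {v : Site} : v ∈ nearAxis R ↔ R - 1 ≤ 2 * v.1 + v.2 := Iff.rfl

theorem mem_leftLine {v : Site} : v ∈ leftLine ↔ v.1 = 0 := Iff.rfl

theorem mem_botLine {v : Site} : v ∈ botLine ↔ v.2 = 0 := Iff.rfl

theorem mem_diagLine {R : ℤ} {v : Site} : v ∈ diagLine R ↔ v.1 + v.2 = R := Iff.rfl

theorem mem_rightArc {R : ℤ} {v : Site} :
    v ∈ rightArc R ↔ v.1 + v.2 = R ∨ (v.2 = 0 ∧ R - 1 ≤ 2 * v.1) := Iff.rfl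

theorem mem_leftArc {R : ℤ} {v : Site} :
    v ∈ leftArc R ↔ v.1 = 0 ∨ (v.2 = 0 ∧ 2 * v.1 ≤ R + 1) := Iff.rfl

theorem mirror_fst (R : ℤ) (v : Site) : (mirror R v).1 = R - v.1 - v.2 := rfl

theorem mirror_snd (R : ℤ) (v : Site) : (mirror R v).2 = v.2 := rfl

theorem mirror_mirror (R : ℤ) (v : Site) : mirror R (mirror R v) = v := (mirror R).left_inv v

theorem Adj.mirror {R : ℤ} {a b : Site} (h : Adj a b) : Adj (mirror R a) (mirror R b) := by
  rw [adj_iff] at *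
  simp only [mirror_fst, mirror_snd]
  omega

theorem site_ext {a b : Site} (h1 : a.1 = b.1) (h2 : a.2 = b.2) : a = b := Prod.ext h1 h2

theorem trap_subset (R b : ℤ) : trap R b ⊆ rect 0 R 0 b := fun v hv => by
  rw [mem_trap] at hv
  rw [mem_rect]
  omega

theorem halfTrap_subset_trap (R b : ℤ) (hR : b ≤ R) : halfTrap R b ⊆ trap R b := fun v hv => by
  rw [mem_halfTrap] at hv
  rw [mem_trap]
  omega

section Doubling

variable {R b : ℤ}

theorem isQuad_halfTrap (hb : 0 ≤ b) (hR : b < R) :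
    IsQuad (halfTrap R b) leftLine (nearAxis R) {v | v.2 = b} botLine where
  crosses_or C := by
    rcases hex (x₀ := 0) (x₁ := R) (by omega) hb (C ∪ (halfTrap R b)ᶜ) with
      ⟨u, v, hu, hv, h⟩ | ⟨t, w, ht, hw, h⟩
    · left
      have h1 := h.left_mem.1
      have h2 := h.right_mem.1
      rw [mem_rect] at h1 h2
      obtain ⟨x, y, h3, h4, h5, h6, -⟩ := h.first_exit (A := halfTrap R b)
        (by rw [mem_halfTrap]; omega) (by rw [mem_halfTrap]; omega)
      refine ⟨u, hu, x, ?_, h3.mono ?_⟩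
      · have h7 := h3.right_mem.2
        have h8 := h5.1
        rw [mem_rect] at h8
        rw [mem_halfTrap] at h6 h7
        rw [mem_nearAxis]
        rw [adj_iff] at h4
        omega
      · rintro z ⟨⟨hz1, hz2⟩, hz3⟩
        rcases hz2 with hz2 | hz2
        · exact ⟨hz3, hz2⟩
        · exact absurd hz3 hz2
    · right
      refine ⟨t, ht, w, hw, h.mono ?_⟩
      rintro z ⟨hz1, hz2⟩
      exact ⟨by_contra fun h => hz2 (.inr h), fun h => hz2 (.inl h)⟩
  meet p hp s hs := by
    rintro ⟨u, hu, v, hv, h⟩ ⟨t, ht, w, hw, h'⟩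
    have hQ : halfTrap R b ⊆ rect 0 R 0 b := (halfTrap_subset_trap R b hR.le).trans (trap_subset R b)
    have hvQ := hp h.right_mem
    rw [mem_nearAxis] at hv
    rw [mem_halfTrap] at hvQ
    have hline : Conn (p ∪ (rect 0 R 0 b \ halfTrap R b)) v (R, v.2) := by
      refine Conn.hline (by omega) fun i h1 h2 => ?_
      rcases eq_or_lt_of_le h1 with rfl | h1
      · exact .inl h.right_mem
      · refine .inr ⟨?_, ?_⟩
        · rw [mem_rect]
          simp only
          omega
        · rw [mem_halfTrap]
          simp only
          omega
    obtain ⟨z, hz1, hz2⟩ := crossings_meet (x₀ := 0) (x₁ := R) (y₀ := 0) (y₁ := b)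
      (p := p ∪ (rect 0 R 0 b \ halfTrap R b)) (s := s)
      (Set.union_subset (hp.trans hQ) Set.sdiff_subset) (hs.trans hQ)
      ((h.mono Set.subset_union_left).trans hline) h' hu rfl ht hw
    rcases hz1 with hz1 | hz1
    · exact ⟨z, hz1, hz2⟩
    · exact absurd (hs hz2) hz1.2

/-- The sites of the half trapezoid strictly below its highest open crossing. -/
def lowSet (R b : ℤ) (ω : Config) : Set Site :=
  Low (halfTrap R b) leftLine (nearAxis R) botLine (openSet ω)

/-- `lowSet` together with its mirror image. -/
def symLow (R b : ℤ) (ω : Config) : Set Site :=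
  {v | v ∈ lowSet R b ω ∨ mirror R v ∈ lowSet R b ω}

open Classical in
/-- Mirroring and negating a configuration below the highest crossing. -/
noncomputable def fold (R b : ℤ) (ω : Config) : Config := fun v =>
  if v ∈ symLow R b ω then !ω (mirror R v) else ω v

theorem lowSet_subset {ω : Config} : lowSet R b ω ⊆ halfTrap R b := Low_subset

theorem mirror_mem_symLow {ω : Config} {v : Site} :
    mirror R v ∈ symLow R b ω ↔ v ∈ symLow R b ω := by
  simp only [symLow, Set.mem_ofPred_eq, mirror_mirror]
  exact or_comm

theorem symLow_subset (hR : b ≤ R) {ω : Config} : symLow R b ω ⊆ trap R b := by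
  rintro v (hv | hv)
  · exact halfTrap_subset_trap R b hR (lowSet_subset hv)
  · have := lowSet_subset hv
    rw [mem_halfTrap, mirror_fst, mirror_snd] at this
    rw [mem_trap]
    omega

theorem mem_lowSet_of_mem_symLow {ω : Config} {v : Site} (hv : v ∈ symLow R b ω)
    (hvQ : v ∈ halfTrap R b) : v ∈ lowSet R b ω := by
  rcases hv with hv | hv
  · exact hv
  · have h := lowSet_subset hv
    rw [mem_halfTrap, mirror_fst, mirror_snd] at h
    rw [mem_halfTrap] at hvQ
    have : mirror R v = v := site_ext (by rw [mirror_fst]; omega) rfl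
    rwa [this] at hv

theorem fold_spec (hb : 0 ≤ b) (hR : b < R) {ω : Config}
    (h : ω ∈ Ev (halfTrap R b) leftLine (nearAxis R)) :
    fold R b ω ∈ Ev (halfTrap R b) leftLine (nearAxis R) ∧
      lowSet R b (fold R b ω) = lowSet R b ω := by
  refine (isQuad_halfTrap hb hR).Low_congr h fun v hv hlow => ?_
  have : v ∉ symLow R b ω := fun h => hlow (mem_lowSet_of_mem_symLow h hv)
  simp [openSet, fold, this]

theorem symLow_fold (hb : 0 ≤ b) (hR : b < R) {ω : Config}
    (h : ω ∈ Ev (halfTrap R b) leftLine (nearAxis R)) :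
    symLow R b (fold R b ω) = symLow R b ω := by
  rw [symLow, (fold_spec hb hR h).2, symLow]

theorem fold_fold (hb : 0 ≤ b) (hR : b < R) {ω : Config}
    (h : ω ∈ Ev (halfTrap R b) leftLine (nearAxis R)) : fold R b (fold R b ω) = ω := by
  funext v
  rw [fold, symLow_fold hb hR h]
  by_cases hv : v ∈ symLow R b ω
  · rw [if_pos hv, fold, if_pos (mirror_mem_symLow.2 hv), mirror_mirror, Bool.not_not]
  · rw [if_neg hv, fold, if_neg hv]

theorem mem_Ev_of_joined (hb : 0 ≤ b) (hR : b < R) {ω : Config}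
    (h : ω ∈ Ev (halfTrap R b) leftLine (nearAxis R)) {k : Site} (hk : k ∈ halfTrap R b)
    (hlow : k ∉ lowSet R b ω) (hjoin : k ∈ rightArc R ∨
      ∃ z w, Adj k z ∧ Conn (symLow R b ω ∩ openSet ω) z w ∧ w ∈ rightArc R) :
    ω ∈ Ev (trap R b) leftLine (rightArc R) := by
  obtain ⟨u, hu, v, hv, hc⟩ := (isQuad_halfTrap hb hR).crosses_diff_Low (B := botLine) h
  set p : Set Site := {w | Conn ((halfTrap R b ∩ openSet ω) \ lowSet R b ω) u w} with hp
  have hpc : Crosses p leftLine (nearAxis R) := ⟨u, hu, v, hv, hc.component⟩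
  have hps : p ⊆ (halfTrap R b ∩ openSet ω) \ lowSet R b ω := fun w hw => Conn.right_mem hw
  have hsub : (halfTrap R b ∩ openSet ω) \ lowSet R b ω ⊆ trap R b ∩ openSet ω :=
    fun w hw => ⟨halfTrap_subset_trap R b hR.le hw.1.1, hw.1.2⟩
  rcases hjoin with hka | ⟨z, w, hkz, hzw, hw⟩
  · have hkp : k ∈ p := by
      refine IsQuad.mem_of_mem_bot hps hpc hk ?_ hlow
      rw [mem_halfTrap] at hk
      rw [mem_rightArc] at hka
      rw [mem_botLine]
      omega
    exact ⟨u, hu, k, hka, Conn.mono hsub hkp⟩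
  · have hkp : k ∈ p := by
      have hz := hzw.left_mem.1
      by_cases hzQ : z ∈ halfTrap R b
      · exact IsQuad.mem_of_adj_Low hps hpc (mem_lowSet_of_mem_symLow hz hzQ) hk hlow hkz
      · have hz' : mirror R z ∈ lowSet R b ω := by
          rcases hz with hz | hz
          · exact absurd (lowSet_subset hz) hzQ
          · exact hz
        by_cases hadj : Adj k (mirror R z)
        · exact IsQuad.mem_of_adj_Low hps hpc hz' hk hlow hadj
        · exfalso
          have hzT := symLow_subset hR.le hz
          have : mirror R z = k := by
            rw [adj_iff, mirror_fst, mirror_snd] at hadj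
            rw [adj_iff] at hkz
            rw [mem_halfTrap] at hk hzQ
            rw [mem_trap] at hzT
            refine site_ext ?_ ?_
            · rw [mirror_fst]
              omega
            · rw [mirror_snd]
              omega
          rw [this] at hz'
          exact hlow hz'
    have h1 : Conn (trap R b ∩ openSet ω) u k := Conn.mono hsub hkp
    have h2 : Conn (trap R b ∩ openSet ω) z w :=
      hzw.mono (Set.inter_subset_inter_left _ (symLow_subset hR.le))
    exact ⟨u, hu, w, hw, h1.trans (h2.head h1.right_mem hkz)⟩

theorem fold_mem_Ev_or (hb : 0 ≤ b) (hR : b < R) {ω : Config}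
    (h : ω ∈ Ev (halfTrap R b) leftLine (nearAxis R)) :
    ω ∈ Ev (trap R b) leftLine (rightArc R) ∨
      fold R b ω ∈ Ev (trap R b) leftLine (rightArc R) := by
  have htop : ∀ v : Site, v.2 = b → v ∉ symLow R b ω := by
    rintro v hv (h' | h')
    · exact (isQuad_halfTrap hb hR).top_notMem_Low (t := v) hv h'
    · exact (isQuad_halfTrap hb hR).top_notMem_Low (t := mirror R v) hv h'
  have hVT : symLow R b ω ⊆ trap R b := symLow_subset hR.le
  set K : Set Site := {v | v ∈ halfTrap R b ∧ v ∉ lowSet R b ω} with hK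
  set O₁ : Set Site := {v | v.1 = -2 ∨ (v.2 = b + 1 ∧ 2 * v.1 + b + 1 ≤ R)} with hO₁
  set O₂ : Set Site := {v | (0 ≤ v.2 ∧ v.2 ≤ b ∧ R + 1 ≤ v.1 + v.2) ∨
    (v.2 = -1 ∧ R + 2 ≤ 2 * v.1)} with hO₂
  set C₁ : Set Site := {v | v.2 = b + 2 ∨ (v.2 = b + 1 ∧ R < 2 * v.1 + b + 1)} with hC₁
  set C₂ : Set Site := {v | (v.1 = -1 ∧ v.2 ≤ b) ∨ v.2 = -2 ∨
    (v.2 = -1 ∧ 2 * v.1 ≤ R + 1)} with hC₂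
  have mO₁ : ∀ v : Site, v ∈ O₁ ↔ v.1 = -2 ∨ (v.2 = b + 1 ∧ 2 * v.1 + b + 1 ≤ R) :=
    fun v => Iff.rfl
  have mO₂ : ∀ v : Site, v ∈ O₂ ↔ (0 ≤ v.2 ∧ v.2 ≤ b ∧ R + 1 ≤ v.1 + v.2) ∨
    (v.2 = -1 ∧ R + 2 ≤ 2 * v.1) := fun v => Iff.rfl
  have mC₁ : ∀ v : Site, v ∈ C₁ ↔ v.2 = b + 2 ∨ (v.2 = b + 1 ∧ R < 2 * v.1 + b + 1) :=
    fun v => Iff.rfl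
  have mC₂ : ∀ v : Site, v ∈ C₂ ↔ (v.1 = -1 ∧ v.2 ≤ b) ∨ v.2 = -2 ∨
    (v.2 = -1 ∧ 2 * v.1 ≤ R + 1) := fun v => Iff.rfl
  clear_value O₁ O₂ C₁ C₂
  rcases hex (x₀ := -2) (x₁ := R + 1) (y₀ := -2) (y₁ := b + 2) (by omega) (by omega)
    (O₁ ∪ O₂ ∪ K ∪ (symLow R b ω ∩ openSet ω)) with ⟨u, v, hu, hv, hc⟩ | ⟨t, w, ht, hw, hc⟩
  · left
    have hvA : v ∉ O₁ ∪ K := by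
      have hv1 := hc.right_mem.1
      rintro (h1 | h1)
      · rw [mO₁] at h1
        omega
      · have := h1.1
        rw [mem_halfTrap] at this
        omega
    have hvV : v ∉ symLow R b ω ∩ openSet ω := by
      rintro ⟨h1, -⟩
      have := hVT h1
      rw [mem_trap] at this
      omega
    obtain ⟨k, z, hk, hkA, hkz, hzv⟩ := hc.last_exit (A := O₁ ∪ K)
      (.inl ((mO₁ u).2 (.inl hu))) hvA
    have hmem : ∀ x ∈ (rect (-2) (R + 1) (-2) (b + 2) ∩
        (O₁ ∪ O₂ ∪ K ∪ (symLow R b ω ∩ openSet ω))) \ (O₁ ∪ K),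
        x ∈ O₂ ∨ x ∈ symLow R b ω ∩ openSet ω := by
      rintro x ⟨⟨-, ((h1 | h1) | h1) | h1⟩, h2⟩
      · exact absurd (.inl h1) h2
      · exact .inl h1
      · exact absurd (.inr h1) h2
      · exact .inr h1
    have hkR := hk.1
    have hzm := hmem z hzv.left_mem
    rw [mem_rect] at hkR
    have hkK : k ∈ K := by
      rcases hkA with hkO | hkK
      · exfalso
        have hkz' := hkz
        rw [mO₁] at hkO
        rw [adj_iff] at hkz
        rcases hzm with hz | ⟨hz, -⟩
        · rw [mO₂] at hz
          omega
        · have h1 := hVT hz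
          rw [mem_trap] at h1
          exact htop z (by omega) hz
      · exact hkK
    have hkQ := (mem_halfTrap.1 hkK.1)
    refine mem_Ev_of_joined hb hR h hkK.1 hkK.2 ?_
    rcases hzm with hz | hz
    · left
      rw [mO₂] at hz
      rw [adj_iff] at hkz
      rw [mem_rightArc]
      omega
    · right
      obtain ⟨w, y, hzw, hwy, hy, hyV, -⟩ := hzv.first_exit (A := symLow R b ω ∩ openSet ω) hz hvV
      refine ⟨z, w, hkz, hzw.mono Set.inter_subset_right, ?_⟩
      have hw := hVT hzw.right_mem.2.1
      have hy2 := (hmem y hy).resolve_right hyV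
      rw [mO₂] at hy2
      rw [adj_iff] at hwy
      rw [mem_trap] at hw
      rw [mem_rightArc]
      omega
  · right
    set K' : Set Site := {v | v ∉ halfTrap R b ∧ mirror R v ∈ K} with hK'
    have hmem : ∀ x ∈ (rect (-2) (R + 1) (-2) (b + 2) \
        (O₁ ∪ O₂ ∪ K ∪ (symLow R b ω ∩ openSet ω))),
        x ∈ C₁ ∨ x ∈ K' ∨ x ∈ C₂ ∨ x ∈ symLow R b ω ∩ (openSet ω)ᶜ := by
      rintro x ⟨hx, hx'⟩
      have n1 : x ∉ O₁ := fun h => hx' (.inl (.inl (.inl h)))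
      have n2 : x ∉ O₂ := fun h => hx' (.inl (.inl (.inr h)))
      have n3 : x ∉ K := fun h => hx' (.inl (.inr h))
      have n4 : x ∉ symLow R b ω ∩ openSet ω := fun h => hx' (.inr h)
      by_cases hxT : x ∈ trap R b
      · by_cases hxV : x ∈ symLow R b ω
        · exact .inr (.inr (.inr ⟨hxV, fun h => n4 ⟨hxV, h⟩⟩))
        · refine .inr (.inl ⟨fun hxQ => n3 ⟨hxQ, fun h => hxV (.inl h)⟩, ?_,
            fun h => hxV (.inr h)⟩)
          have hxQ : x ∉ halfTrap R b := fun hxQ => n3 ⟨hxQ, fun h => hxV (.inl h)⟩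
          rw [mem_trap] at hxT
          rw [mem_halfTrap] at hxQ
          rw [mem_halfTrap, mirror_fst, mirror_snd]
          omega
      · rw [mem_rect] at hx
        rw [mem_trap] at hxT
        rw [mO₁] at n1
        rw [mO₂] at n2
        rw [mC₁, mC₂]
        omega
    have K'T : ∀ x ∈ K', x ∈ trap R b ∧ R < 2 * x.1 + x.2 := by
      rintro x ⟨h1, h2, -⟩
      rw [mem_halfTrap, mirror_fst, mirror_snd] at h2
      rw [mem_halfTrap] at h1
      rw [mem_trap]
      omega
    have htR := hc.left_mem
    have hwR := hc.right_mem
    have hwA : w ∉ C₁ ∪ K' := by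
      rintro (h1 | h1)
      · rw [mC₁] at h1
        omega
      · have := (K'T w h1).1
        rw [mem_trap] at this
        omega
    have hwV : w ∉ symLow R b ω ∩ (openSet ω)ᶜ := by
      rintro ⟨h1, -⟩
      have := hVT h1
      rw [mem_trap] at this
      omega
    obtain ⟨a, z, ha, haA, haz, hzw⟩ := hc.last_exit (A := C₁ ∪ K')
      (.inl ((mC₁ t).2 (.inl ht))) hwA
    have hmem' : ∀ x ∈ (rect (-2) (R + 1) (-2) (b + 2) \
        (O₁ ∪ O₂ ∪ K ∪ (symLow R b ω ∩ openSet ω))) \ (C₁ ∪ K'),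
        x ∈ C₂ ∨ x ∈ symLow R b ω ∩ (openSet ω)ᶜ := by
      rintro x ⟨h1, h2⟩
      rcases hmem x h1 with h3 | h3 | h3
      · exact absurd (.inl h3) h2
      · exact absurd (.inr h3) h2
      · exact h3
    have haR := ha.1
    have hanO : a ∉ O₁ := fun h => ha.2 (.inl (.inl (.inl h)))
    have hzm := hmem' z hzw.left_mem
    rw [mem_rect] at haR
    have haK : a ∈ K' := by
      rcases haA with haC | haK
      · exfalso
        rw [mC₁] at haC
        rw [mO₁] at hanO
        rw [adj_iff] at haz
        rcases hzm with hz | ⟨hz, -⟩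
        · rw [mC₂] at hz
          omega
        · have h1 := hVT hz
          rw [mem_trap] at h1
          exact htop z (by omega) hz
      · exact haK
    obtain ⟨haT, haX⟩ := K'T a haK
    rw [mem_trap] at haT
    obtain ⟨f1, f2⟩ := fold_spec hb hR h
    refine mem_Ev_of_joined hb hR f1 haK.2.1 (by rw [f2]; exact haK.2.2) ?_
    rw [symLow_fold hb hR h]
    rcases hzm with hz | hz
    · left
      rw [mC₂] at hz
      rw [adj_iff] at haz
      rw [mem_rightArc, mirror_fst, mirror_snd]
      omega
    · right
      obtain ⟨x, y, hzx, hxy, hy, hyV, -⟩ :=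
        hzw.first_exit (A := symLow R b ω ∩ (openSet ω)ᶜ) hz hwV
      refine ⟨mirror R z, mirror R x, haz.mirror, ?_, ?_⟩
      · refine hzx.map _ (fun _ _ h => h.mirror) ?_
        rintro i ⟨-, hi1, hi2⟩
        refine ⟨mirror_mem_symLow.2 hi1, ?_⟩
        rw [mem_openSet] at *
        rw [fold, if_pos (mirror_mem_symLow.2 hi1), mirror_mirror]
        simpa [openSet] using hi2
      · have hx := hVT hzx.right_mem.2.1
        have hy2 := (hmem' y hy).resolve_right hyV
        have hyR := hy.1.1
        rw [mem_rect] at hyR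
        rw [mC₂] at hy2
        rw [adj_iff] at hxy
        rw [mem_trap] at hx
        rw [mem_rightArc, mirror_fst, mirror_snd]
        omega

end Doubling

section RSW

variable {R b : ℤ}

theorem inter_subset_diag (hb : 0 ≤ b) :
    Ev (trap R b) leftLine (rightArc R) ∩ Ev (trap R b) (diagLine R) (leftArc R) ⊆
      Ev (trap R b) leftLine (diagLine R) := by
  rintro ω ⟨⟨u, hu, e, he, h⟩, ⟨v, hv, f, hf, h'⟩⟩
  by_cases he1 : e.1 + e.2 = R
  · exact ⟨u, hu, e, he1, h⟩
  by_cases hf1 : f.1 = 0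
  · exact ⟨f, hf1, v, hv, h'.symm⟩
  rw [mem_rightArc] at he
  rw [mem_leftArc] at hf
  rw [mem_leftLine] at hu
  rw [mem_diagLine] at hv
  have heT := h.right_mem.1
  have hfT := h'.right_mem.1
  have hvT := h'.left_mem.1
  rw [mem_trap] at heT hfT hvT
  suffices hs : Conn (trap R b ∩ openSet ω) u v from ⟨u, hu, v, hv, hs⟩
  rcases lt_trichotomy f.1 e.1 with hlt | heq | hgt
  · set p : Set Site := {z | Conn (trap R b ∩ openSet ω) u z} with hp
    set q : Set Site := {z | Conn (trap R b ∩ openSet ω) v z} with hq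
    have hpT : p ⊆ trap R b := fun z hz => (Conn.right_mem hz).1
    have hqT : q ⊆ trap R b := fun z hz => (Conn.right_mem hz).1
    have hTR : trap R b ⊆ rect 0 R (-1) b := fun z hz => by
      rw [mem_trap] at hz
      rw [mem_rect]
      omega
    have c1 : Conn (p ∪ {z | z.2 = -1 ∧ e.1 ≤ z.1 ∧ z.1 ≤ R}) u (R, -1) := by
      refine ((h.component.mono Set.subset_union_left).tail (w := (e.1, -1)) ?_ ?_).trans
        (Conn.hline (by omega) fun i h1 h2 => .inr ⟨rfl, h1, h2⟩)
      · rw [adj_iff]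
        omega
      · exact .inr ⟨rfl, le_rfl, by dsimp only; omega⟩
    have c2 : Conn (q ∪ {z | z = (f.1, -1) ∨ z.1 = R - v.2 ∧ v.2 < z.2 ∧ z.2 ≤ b}) v (f.1, -1) := by
      refine (h'.component.mono Set.subset_union_left).tail ?_ (.inr (.inl rfl))
      rw [adj_iff]
      omega
    have c3 : Conn (q ∪ {z | z = (f.1, -1) ∨ z.1 = R - v.2 ∧ v.2 < z.2 ∧ z.2 ≤ b}) v
        (v.1, b) := by
      refine Conn.vline (x := v.1) (a := v.2) (by omega) fun i h1 h2 => ?_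
      rcases eq_or_lt_of_le h1 with rfl | h1
      · exact .inl (Conn.refl h'.left_mem)
      · exact .inr (.inr ⟨by dsimp only; omega, h1, h2⟩)
    obtain ⟨z, hz1, hz2⟩ := crossings_meet (x₀ := 0) (x₁ := R) (y₀ := -1) (y₁ := b)
      (Set.union_subset (hpT.trans hTR) (by
        rintro z ⟨h1, h2, h3⟩
        rw [mem_rect]
        omega)) (Set.union_subset (hqT.trans hTR) (by
        rintro z (rfl | ⟨h1, h2, h3⟩)
        · rw [mem_rect]
          dsimp only
          omega
        · rw [mem_rect]
          omega)) c1 (c3.symm.trans c2) hu rfl rfl rfl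
    rcases hz1 with hz1 | ⟨h1, h2, h3⟩
    · rcases hz2 with hz2 | hz2 | ⟨h1, h2, h3⟩
      · exact Conn.trans hz1 (Conn.symm hz2)
      · have := hpT hz1
        rw [mem_trap, hz2] at this
        dsimp only at this
        omega
      · have := hpT hz1
        rw [mem_trap] at this
        omega
    · rcases hz2 with hz2 | hz2 | ⟨h4, h5, h6⟩
      · have := hqT hz2
        rw [mem_trap] at this
        omega
      · rw [hz2] at h2
        dsimp only at h2
        omega
      · omega
  · have : e = f := site_ext heq.symm (by omega)
    rw [this] at h
    exact h.trans h'.symm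
  · refine h.trans (h'.symm.head h.right_mem ?_)
    rw [adj_iff]
    omega

variable {μ : Measure Config} (hμ : IsBernoulliHalf μ)
include hμ

theorem measureReal_halfTrap_le (hb : 0 ≤ b) (hR : b < R) :
    μ.real (Ev (halfTrap R b) leftLine (nearAxis R)) ≤
      2 * μ.real (Ev (trap R b) leftLine (rightArc R)) := by
  have := hμ.1
  set H := Ev (halfTrap R b) leftLine (nearAxis R)
  set E := Ev (trap R b) leftLine (rightArc R)
  have dH : Dep H (rectFinset 0 R 0 b) := dep_Ev (subset_rectFinset
    ((halfTrap_subset_trap R b hR.le).trans (trap_subset R b))) _ _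
  have dE : Dep E (rectFinset 0 R 0 b) := dep_Ev (subset_rectFinset (trap_subset R b)) _ _
  have h1 : μ.real (H \ E) ≤ μ.real E := by
    refine measureReal_le_of_injOn hμ (dH.sdiff dE) dE (fold R b) ?_ ?_ ?_
    · intro ω v hv
      refine if_neg fun h => hv ?_
      exact mem_rectFinset.2 (trap_subset R b (symLow_subset hR.le h))
    · rintro ω ⟨h1, h2⟩
      exact (fold_mem_Ev_or hb hR h1).resolve_left h2
    · rintro ω ⟨h1, -⟩ ω' ⟨h2, -⟩ heq
      rw [← fold_fold hb hR h1, heq, fold_fold hb hR h2]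
  have h2 : μ.real H ≤ μ.real (H \ E) + μ.real E :=
    (measureReal_mono (fun ω hω => by
      by_cases h : ω ∈ E
      · exact .inr h
      · exact .inl ⟨hω, h⟩)).trans (measureReal_union_le _ _)
  linarith

theorem le_measureReal_diag (hb : 0 ≤ b) (hR : b < R) :
    (μ.real (Ev (halfTrap R b) leftLine (nearAxis R)) / 2) ^ 2 ≤
      μ.real (Ev (trap R b) leftLine (diagLine R)) := by
  have := hμ.1
  have hT := subset_rectFinset (trap_subset R b)
  have h1 := measureReal_halfTrap_le hμ hb hR
  have h2 : μ.real (Ev (trap R b) leftLine (rightArc R)) ≤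
      μ.real (Ev (trap R b) (diagLine R) (leftArc R)) := by
    refine measureReal_Ev_le hμ hT (mirror R) (fun _ _ h => h.mirror) ?_ ?_ ?_
    · intro v hv
      rw [mem_trap] at *
      rw [mirror_fst, mirror_snd]
      omega
    · intro v _ hv
      rw [mem_leftLine] at hv
      rw [mem_diagLine, mirror_fst, mirror_snd]
      omega
    · intro v _ hv
      rw [mem_rightArc] at hv
      rw [mem_leftArc, mirror_fst, mirror_snd]
      omega
  have h3 := le_measureReal_inter hμ (dep_Ev hT leftLine (rightArc R))
    (dep_Ev hT (diagLine R) (leftArc R)) (isUpperSet_Ev _ _ _) (isUpperSet_Ev _ _ _)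
  have h4 := measureReal_mono (μ := μ) (inter_subset_diag hb)
  have h5 : 0 ≤ μ.real (Ev (halfTrap R b) leftLine (nearAxis R)) := measureReal_nonneg
  have h6 : 0 ≤ μ.real (Ev (trap R b) leftLine (rightArc R)) := measureReal_nonneg
  calc _ ≤ μ.real (Ev (trap R b) leftLine (rightArc R)) ^ 2 := by
        refine pow_le_pow_left₀ (by linarith) (by linarith) 2
    _ ≤ _ := by
        rw [sq]
        exact (mul_le_mul_of_nonneg_left h2 h6).trans (h3.trans h4)

omit hμ in
theorem mem_halfTrap_crossing (hR : b < R) {ω : Config} {S : Set Site}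
    (hS : ∀ v ∈ S, 0 ≤ v.1 ∧ 0 ≤ v.2 ∧ v.2 ≤ b) {u v : Site} (hu : u.1 = 0)
    (hv : R ≤ 2 * v.1 + v.2) (h : Conn (S ∩ openSet ω) u v) :
    ω ∈ Ev (halfTrap R b) leftLine (nearAxis R) := by
  have huS := hS u h.left_mem.1
  have hsub : S ∩ openSet ω ∩ {z | 2 * z.1 + z.2 ≤ R} ⊆ halfTrap R b ∩ openSet ω := by
    rintro z ⟨⟨hz1, hz2⟩, hz3⟩
    have := hS z hz1
    exact ⟨⟨this.1, this.2.1, this.2.2, hz3⟩, hz2⟩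
  rcases h.subset_or_first_exit (A := {z | 2 * z.1 + z.2 ≤ R})
    (show 2 * u.1 + u.2 ≤ R by omega) with h1 | ⟨x, y, h1, hxy, -, hy, -⟩
  · refine ⟨u, hu, v, ?_, h1.mono hsub⟩
    rw [mem_nearAxis]
    omega
  · refine ⟨u, hu, x, ?_, h1.mono hsub⟩
    have hy' : ¬ (2 * y.1 + y.2 ≤ R) := hy
    rw [adj_iff] at hxy
    rw [mem_nearAxis]
    omega

/-- A Russo–Seymour–Welsh estimate: rectangles of aspect ratio two are crossed in the long
direction with uniformly positive probability. -/
theorem le_measureReal_HEv {n : ℤ} (hn : 1 ≤ n) : 1 / 1024 ≤ μ.real (HEv 0 (2 * n) 0 n) := by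
  have := hμ.1
  have h1 : (1 : ℝ) / 2 ≤ μ.real (Ev (halfTrap (2 * n) n) leftLine (nearAxis (2 * n))) := by
    rw [← measureReal_HEv_square (x₀ := 0) (x₁ := n) hμ (by omega)]
    refine measureReal_mono ?_
    rintro ω ⟨u, hu, v, hv, h⟩
    have hvR := h.right_mem.1
    rw [mem_rect] at hvR
    have hv : v.1 = n := hv
    refine mem_halfTrap_crossing (by omega) (fun z hz => ?_) hu (by omega) h
    rw [mem_rect] at hz
    omega
  have h2 : (1 : ℝ) / 16 ≤ μ.real (Ev (halfTrap (3 * n) n) leftLine (nearAxis (3 * n))) := by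
    have h := le_measureReal_diag (R := 2 * n) (b := n) hμ (by omega) (by omega)
    refine le_trans ?_ (h.trans (measureReal_mono ?_))
    · nlinarith
    · rintro ω ⟨u, hu, v, hv, h⟩
      have hvT := h.right_mem.1
      rw [mem_trap] at hvT
      rw [mem_diagLine] at hv
      refine mem_halfTrap_crossing (by omega) (fun z hz => ?_) hu (by omega) h
      rw [mem_trap] at hz
      omega
  have h := le_measureReal_diag (R := 3 * n) (b := n) hμ (by omega) (by omega)
  refine le_trans ?_ (h.trans (measureReal_mono ?_))
  · nlinarith
  · rintro ω ⟨u, hu, v, hv, h⟩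
    have hvT := h.right_mem.1
    rw [mem_trap] at hvT
    rw [mem_diagLine] at hv
    rw [mem_leftLine] at hu
    have hsub : trap (3 * n) n ∩ openSet ω ∩ {z | z.1 ≤ 2 * n} ⊆
        rect 0 (2 * n) 0 n ∩ openSet ω := by
      rintro z ⟨⟨hz1, hz2⟩, hz3⟩
      have hz3 : z.1 ≤ 2 * n := hz3
      rw [mem_trap] at hz1
      refine ⟨?_, hz2⟩
      rw [mem_rect]
      omega
    rcases h.subset_or_first_exit (A := {z | z.1 ≤ 2 * n})
      (show u.1 ≤ 2 * n by omega) with h1 | ⟨x, y, h1, hxy, -, hy, -⟩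
    · have hv' : v.1 ≤ 2 * n := h1.right_mem.2
      exact ⟨u, hu, v, show v.1 = 2 * n by omega, h1.mono hsub⟩
    · have hy' : ¬ (y.1 ≤ 2 * n) := hy
      have hx' : x.1 ≤ 2 * n := h1.right_mem.2
      rw [adj_iff] at hxy
      exact ⟨u, hu, x, show x.1 = 2 * n by omega, h1.mono hsub⟩

end RSW

section Differences

variable {x₀ x₁ : ℤ} {μ : Measure Config} (hμ : IsBernoulliHalf μ)
include hμ

theorem measureReal_HEv_sdiff {y₀ y₁ y₀' y₁' : ℤ} (h0 : y₀ ≤ y₀') (h1 : y₁' ≤ y₁) :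
    μ.real (HEv x₀ x₁ y₀ y₁ \ HEv x₀ x₁ y₀' y₁') =
      μ.real (HEv x₀ x₁ y₀ y₁) - μ.real (HEv x₀ x₁ y₀' y₁') := by
  have := hμ.1
  exact measureReal_sdiff (HEv_mono h0 h1) dep_HEv.measurableSet

theorem measureReal_HEv_rows (a L : ℤ) :
    μ.real (HEv x₀ x₁ a (a + L)) = μ.real (HEv x₀ x₁ 0 L) := by
  have := measureReal_HEv_translate hμ (x₀ := x₀) (x₁ := x₁) (y₀ := 0) (y₁ := L) 0 a
  rw [← this]
  congr 2 <;> ring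

/-- Horizontal crossings of vertically disjoint rectangles are negatively correlated. -/
theorem measureReal_HEv_inter_le {y₀ y₁ y₀' y₁' : ℤ} (h : y₁ < y₀') :
    μ.real (HEv x₀ x₁ y₀ y₁ ∩ HEv x₀ x₁ y₀' y₁') ≤
      μ.real (HEv x₀ x₁ y₀ y₁) * μ.real (HEv x₀ x₁ y₀' y₁') := by
  classical
  have := hμ.1
  refine le_trans (measureReal_mono ?_) (measureReal_box_le hμ
    (dep_HEv.mono (Finset.subset_union_left (s₂ := rectFinset x₀ x₁ y₀' y₁')))
    (dep_HEv.mono Finset.subset_union_right) (isUpperSet_Ev _ _ _) (isUpperSet_Ev _ _ _))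
  rintro ω ⟨⟨u, hu, v, hv, h1⟩, u', hu', v', hv', h2⟩
  refine ⟨fun w => ω w && decide (w.2 ≤ y₁), ⟨u, hu, v, hv, h1.mono fun w hw => ⟨hw.1, ?_⟩⟩,
    fun w => ω w && decide (y₁ < w.2), ⟨u', hu', v', hv', h2.mono fun w hw => ⟨hw.1, ?_⟩⟩,
    fun w => ?_, fun w => ?_, fun w hw => ?_⟩
  · have := mem_rect.1 hw.1
    have := mem_openSet.1 hw.2
    simp only [mem_openSet, Bool.and_eq_true, decide_eq_true_eq]
    exact ⟨this, by omega⟩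
  · have := mem_rect.1 hw.1
    have := mem_openSet.1 hw.2
    simp only [mem_openSet, Bool.and_eq_true, decide_eq_true_eq]
    exact ⟨this, by omega⟩
  · rw [Bool.le_iff_true]
    simp +contextual
  · rw [Bool.le_iff_true]
    simp +contextual
  · simp only [Bool.and_eq_true, decide_eq_true_eq] at hw
    omega

theorem measureReal_shift_sdiff_le (L : ℤ) (W : ℕ) :
    μ.real (HEv x₀ x₁ W (W + L) \ HEv x₀ x₁ 0 L) ≤
      W * (μ.real (HEv x₀ x₁ 0 (L + 1)) - μ.real (HEv x₀ x₁ 0 L)) := by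
  have := hμ.1
  induction W with
  | zero => simp
  | succ W ih =>
    have h1 : HEv x₀ x₁ ((W + 1 : ℕ) : ℤ) ((W + 1 : ℕ) + L) \ HEv x₀ x₁ 0 L ⊆
        (HEv x₀ x₁ W (W + (L + 1)) \ HEv x₀ x₁ W (W + L)) ∪
          (HEv x₀ x₁ W (W + L) \ HEv x₀ x₁ 0 L) := by
      rintro ω ⟨h1, h2⟩
      by_cases h : ω ∈ HEv x₀ x₁ W (W + L)
      · exact .inr ⟨h, h2⟩
      · exact .inl ⟨HEv_mono (by push_cast; omega) (by push_cast; omega) h1, h⟩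
    have h2 := (measureReal_mono (μ := μ) h1).trans (measureReal_union_le _ _)
    rw [measureReal_HEv_sdiff hμ le_rfl (by omega), measureReal_HEv_rows hμ,
      measureReal_HEv_rows hμ] at h2
    push_cast at h2 ⊢
    linarith

theorem le_measureReal_HEv_succ_sub (L : ℕ) :
    μ.real (HEv x₀ x₁ 0 L) * (1 - μ.real (HEv x₀ x₁ 0 L)) ≤
      (L + 1) * (μ.real (HEv x₀ x₁ 0 (L + 1)) - μ.real (HEv x₀ x₁ 0 L)) := by
  have := hμ.1
  have h1 := measureReal_shift_sdiff_le (x₀ := x₀) (x₁ := x₁) hμ L (L + 1)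
  have h2 := measureReal_HEv_inter_le (x₀ := x₀) (x₁ := x₁) hμ (y₀ := 0) (y₁ := L)
    (y₀' := (L + 1 : ℕ)) (y₁' := (L + 1 : ℕ) + L) (by push_cast; omega)
  have h3 := measureReal_inter_add_sdiff (μ := μ)
    (s := HEv x₀ x₁ (L + 1 : ℕ) ((L + 1 : ℕ) + L)) (dep_HEv (x₀ := x₀) (x₁ := x₁) (y₀ := 0) (y₁ := L)).measurableSet
  rw [Set.inter_comm] at h3
  rw [measureReal_HEv_rows hμ] at h2 h3
  push_cast at h1 h2 h3
  nlinarith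

end Differences

/-- The `j`-fold disjoint occurrence of the event `V`. -/
def iterBox (V : Set Config) : ℕ → Set Config
  | 0 => Set.univ
  | j + 1 => Box V (iterBox V j)

theorem isUpperSet_iterBox (V : Set Config) (j : ℕ) : IsUpperSet (iterBox V j) := by
  cases j with
  | zero => exact isUpperSet_univ
  | succ j => exact isUpperSet_box _ _

theorem Dep.iterBox {V : Set Config} {Λ : Finset Site} (h : Dep V Λ) (j : ℕ) :
    Dep (iterBox V j) Λ := by
  induction j with
  | zero => exact fun _ _ _ _ => trivial
  | succ j ih => exact h.box ih

theorem measureReal_iterBox_le {μ : Measure Config} (hμ : IsBernoulliHalf μ) {V : Set Config}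
    {Λ : Finset Site} (h : Dep V Λ) (uV : IsUpperSet V) (j : ℕ) :
    μ.real (iterBox V j) ≤ μ.real V ^ j := by
  have := hμ.1
  induction j with
  | zero => simp [iterBox]
  | succ j ih =>
    refine (measureReal_box_le hμ h (h.iterBox j) uV (isUpperSet_iterBox V j)).trans ?_
    rw [pow_succ']
    exact mul_le_mul_of_nonneg_left ih measureReal_nonneg

open Classical in
theorem mem_iterBox_card {ι : Type*} {V : Set Config} {s : ι → Set Site} (T : Finset ι) :
    ∀ {η : Config}, (∀ t ∈ T, s t ⊆ openSet η) → (∀ t ∈ T, (fun v => decide (v ∈ s t)) ∈ V) →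
      (∀ t ∈ T, ∀ t' ∈ T, t ≠ t' → Disjoint (s t) (s t')) → η ∈ iterBox V T.card := by
  induction T using Finset.induction_on with
  | empty => exact fun _ _ _ => trivial
  | insert a T ha ih =>
    intro η h1 h2 h3
    rw [Finset.card_insert_of_notMem ha]
    simp only [Finset.mem_insert, forall_eq_or_imp] at h1 h2
    refine ⟨_, h2.1, fun v => decide (∃ t ∈ T, v ∈ s t), ih (fun t ht v hv => ?_) h2.2
      (fun t ht t' ht' => h3 t (Finset.mem_insert_of_mem ht) t' (Finset.mem_insert_of_mem ht')),
      fun v => ?_, fun v => ?_, fun v => ?_⟩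
    · rw [mem_openSet, decide_eq_true_eq]
      exact ⟨t, ht, hv⟩
    · rw [Bool.le_iff_true, decide_eq_true_eq]
      exact fun hv => h1.1 hv
    · rw [Bool.le_iff_true, decide_eq_true_eq]
      rintro ⟨t, ht, hv⟩
      exact h1.2 t ht hv
    · simp only [decide_eq_true_eq]
      rintro ⟨hv, t, ht, hv'⟩
      exact Set.disjoint_left.1 (h3 a (Finset.mem_insert_self _ _) t (Finset.mem_insert_of_mem ht)
        fun h => ha (h ▸ ht)) hv hv'

theorem VEv_anti {x₀ x₁ y₀ y₁ y₀' y₁' : ℤ} (hx : x₀ ≤ x₁) (hy : y₀ ≤ y₁) (h0 : y₀' ≤ y₀)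
    (h1 : y₁ ≤ y₁') : VEv x₀ x₁ y₀' y₁' ⊆ VEv x₀ x₁ y₀ y₁ := by
  intro ω hω
  have h : negate (negate ω) = ω := by
    funext v
    simp [negate_apply]
  rw [← h, negate_mem_VEv_iff hx (by omega)] at hω ⊢
  exact fun h => hω (HEv_mono h0 h1 h)

/-- If the events `HEv t (t + L + 1) \ HEv t (t + L)`, `t ∈ T`, all occur then there are as many
disjoint closed vertical crossings of the common rows. -/
theorem negate_mem_iterBox {x₀ x₁ L : ℤ} (hx : x₀ ≤ x₁) {W : ℕ} (hW : (W : ℤ) ≤ L + 1)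
    {ω : Config} {T : Finset ℕ} (hT : ∀ t ∈ T, t < W ∧ ω ∈ HEv x₀ x₁ t (t + (L + 1)) \
      HEv x₀ x₁ t (t + L)) : negate ω ∈ iterBox (VEv x₀ x₁ (W - 1) L) T.card := by
  classical
  have h : ∀ t : ℕ, ∃ s : Set Site, t ∈ T → ∃ u v, u.2 = t + L ∧ v.2 = (t : ℤ) ∧ u ∈ s ∧
      s = {w | Conn (rect x₀ x₁ t (t + L) ∩ openSet (negate ω)) v w} := by
    intro t
    by_cases ht : t ∈ T
    · obtain ⟨h1, -, h2⟩ := hT t ht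
      rw [← negate_mem_VEv_iff hx (by omega)] at h2
      obtain ⟨u, hu, v, hv, h⟩ := h2
      exact ⟨_, fun _ => ⟨u, v, hu, hv, h.symm, rfl⟩⟩
    · exact ⟨∅, fun h => absurd h ht⟩
  choose s hs using h
  have hdisj : ∀ t ∈ T, ∀ t' ∈ T, t < t' → Disjoint (s t) (s t') := by
    intro t ht t' ht' hlt
    rw [Set.disjoint_left]
    intro w hw hw'
    obtain ⟨u, v, hu, hv, hus, hs1⟩ := hs t ht
    obtain ⟨u', v', hu', hv', hus', hs2⟩ := hs t' ht'
    rw [hs1] at hw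
    rw [hs2] at hw' hus'
    obtain ⟨htW, hH, -⟩ := hT t ht
    have hlt' : (t : ℤ) < t' := by exact_mod_cast hlt
    have hV : negate ω ∈ VEv x₀ x₁ t (t' + L) := by
      refine ⟨u', hu', v, hv, ?_⟩
      have e1 : rect x₀ x₁ t (t + L) ∩ openSet (negate ω) ⊆
          rect x₀ x₁ t (t' + L) ∩ openSet (negate ω) :=
        fun z hz => ⟨by have := hz.1; rw [mem_rect] at *; omega, hz.2⟩
      have e2 : rect x₀ x₁ t' (t' + L) ∩ openSet (negate ω) ⊆
          rect x₀ x₁ t (t' + L) ∩ openSet (negate ω) :=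
        fun z hz => ⟨by have := hz.1; rw [mem_rect] at *; omega, hz.2⟩
      exact ((Conn.symm hus').trans hw' |>.mono e2).trans ((Conn.symm hw).mono e1)
    rw [negate_mem_VEv_iff hx (by omega)] at hV
    exact hV (HEv_mono le_rfl (by omega) hH)
  refine mem_iterBox_card T (s := s) (fun t ht => ?_) (fun t ht => ?_) fun t ht t' ht' hne => ?_
  · obtain ⟨u, v, -, -, -, h⟩ := hs t ht
    rw [h]
    exact fun w hw => (Conn.right_mem hw).2
  · obtain ⟨u, v, hu, hv, hus, h⟩ := hs t ht
    have htW := (hT t ht).1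
    refine VEv_anti (y₀' := t) (y₁' := t + L) hx (by omega) (by omega) (by omega)
      ⟨u, hu, v, hv, ?_⟩
    rw [h] at hus
    refine (Conn.mono (fun z hz => ?_) hus.component).symm
    refine ⟨(Conn.right_mem hz).1, ?_⟩
    rw [mem_openSet, decide_eq_true_eq, h]
    exact hz
  · rcases lt_or_gt_of_ne hne with h | h
    · exact hdisj t ht t' ht' h
    · exact (hdisj t' ht' t ht h).symm

theorem sum_measureReal_le {μ : Measure Config} [IsProbabilityMeasure μ] {W : ℕ}
    {E B : ℕ → Set Config} (hE : ∀ t, MeasurableSet (E t)) (hB : ∀ t, MeasurableSet (B t))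
    (h : ∀ ω, ∀ T ⊆ Finset.range W, (∀ t ∈ T, ω ∈ E t) → ω ∈ B T.card) :
    ∑ t ∈ Finset.range W, μ.real (E t) ≤ ∑ j ∈ Finset.range W, μ.real (B (j + 1)) := by
  classical
  have hi : ∀ A : ℕ → Set Config, (∀ t, MeasurableSet (A t)) →
      ∑ t ∈ Finset.range W, μ.real (A t) =
        ∫ ω, ∑ t ∈ Finset.range W, (A t).indicator 1 ω ∂μ := by
    intro A hA
    rw [integral_finsetSum]
    · exact Finset.sum_congr rfl fun t _ => (integral_indicator_one (hA t)).symm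
    · exact fun t _ => (integrable_const (1 : ℝ)).indicator (hA t)
  rw [hi E hE, hi (fun j => B (j + 1)) fun j => hB _]
  refine integral_mono (integrable_finsetSum _ fun t _ => (integrable_const (1 : ℝ)).indicator (hE t))
    (integrable_finsetSum _ fun t _ => (integrable_const (1 : ℝ)).indicator (hB _)) fun ω => ?_
  simp only [Set.indicator_apply, Pi.one_apply, Finset.sum_boole]
  rw [Nat.cast_le]
  set T := (Finset.range W).filter fun t => ω ∈ E t
  have hTW : T.card ≤ W := (Finset.card_filter_le _ _).trans (Finset.card_range W).le
  calc T.card = (Finset.range T.card).card := (Finset.card_range _).symm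
    _ ≤ _ := Finset.card_le_card fun j hj => ?_
  rw [Finset.mem_range] at hj
  rw [Finset.mem_filter, Finset.mem_range]
  refine ⟨by omega, ?_⟩
  obtain ⟨T', hT', hc⟩ := Finset.exists_subset_card_eq (show j + 1 ≤ T.card from hj)
  rw [← hc]
  exact h ω T' (hT'.trans (Finset.filter_subset _ _)) fun t ht =>
    (Finset.mem_filter.1 (hT' ht)).2

theorem measureReal_HEv_succ_sub_le {x₀ x₁ L : ℤ} (hx : x₀ ≤ x₁) {W : ℕ} (hW : (W : ℤ) ≤ L + 1)
    {μ : Measure Config} (hμ : IsBernoulliHalf μ) :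
    W * (μ.real (HEv x₀ x₁ 0 (L + 1)) - μ.real (HEv x₀ x₁ 0 L)) *
      μ.real (HEv x₀ x₁ 0 (L + 1 - W)) ≤ 1 := by
  have := hμ.1
  have dV : Dep (VEv x₀ x₁ (W - 1) L) _ := dep_VEv
  have h1 := sum_measureReal_le (μ := μ) (W := W)
    (E := fun t => HEv x₀ x₁ t (t + (L + 1)) \ HEv x₀ x₁ t (t + L))
    (B := fun j => negate ⁻¹' iterBox (VEv x₀ x₁ (W - 1) L) j)
    (fun t => dep_HEv.measurableSet.diff dep_HEv.measurableSet)
    (fun j => measurable_recolor _ _ (dV.iterBox j).measurableSet)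
    fun ω T hT h => negate_mem_iterBox hx hW fun t ht =>
      ⟨Finset.mem_range.1 (hT ht), h t ht⟩
  have h2 : ∀ t : ℕ, μ.real (HEv x₀ x₁ t (t + (L + 1)) \ HEv x₀ x₁ t (t + L)) =
      μ.real (HEv x₀ x₁ 0 (L + 1)) - μ.real (HEv x₀ x₁ 0 L) := fun t => by
    rw [measureReal_HEv_sdiff hμ le_rfl (by omega), measureReal_HEv_rows hμ,
      measureReal_HEv_rows hμ]
  have h3 : μ.real (VEv x₀ x₁ (W - 1) L) = 1 - μ.real (HEv x₀ x₁ 0 (L + 1 - W)) := by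
    rw [measureReal_VEv hμ hx (by omega), ← measureReal_HEv_rows hμ (W - 1)]
    congr 3
    ring
  simp only [h2, measureReal_negate hμ (dV.iterBox _), Finset.sum_const, Finset.card_range,
    nsmul_eq_mul] at h1
  set q := μ.real (VEv x₀ x₁ (W - 1) L) with hq
  have h0 : 0 ≤ q := measureReal_nonneg
  have h4 : ∑ j ∈ Finset.range W, μ.real (iterBox (VEv x₀ x₁ (W - 1) L) (j + 1)) ≤
      q * ∑ j ∈ Finset.range W, q ^ j := by
    rw [Finset.mul_sum]
    refine Finset.sum_le_sum fun j _ => ?_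
    rw [← pow_succ']
    exact measureReal_iterBox_le hμ dV (isUpperSet_Ev _ _ _) _
  have h5 := geom_sum_mul_neg q W
  have h6 : q ≤ 1 := measureReal_le_one
  have h7 : (0 : ℝ) ≤ q ^ W := by positivity
  have h8 : μ.real (HEv x₀ x₁ 0 (L + 1 - W)) = 1 - q := by linarith
  rw [h8]
  calc _ ≤ (q * ∑ j ∈ Finset.range W, q ^ j) * (1 - q) :=
        mul_le_mul_of_nonneg_right (h1.trans h4) (by linarith)
    _ = q * (1 - q ^ W) := by rw [mul_assoc, h5]
    _ ≤ 1 := by nlinarith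

section Bounds

variable {μ : Measure Config} (hμ : IsBernoulliHalf μ) {n m : ℕ}
include hμ

theorem le_measureReal_HEv_rows (hn : 1 ≤ n) {k : ℤ} (hk : n ≤ k) :
    1 / 1024 ≤ μ.real (HEv 0 (2 * n) 0 k) := by
  have := hμ.1
  exact (le_measureReal_HEv hμ (by exact_mod_cast hn)).trans
    (measureReal_mono (HEv_mono le_rfl hk))

omit hμ in
theorem measureReal_HEv_sub_eq_sum (hmn : m ≤ n) :
    μ.real (HEv 0 (2 * n) 0 (2 * n)) - μ.real (HEv 0 (2 * n) 0 (2 * n - m)) =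
      ∑ i ∈ Finset.range m, (μ.real (HEv 0 (2 * n) 0 ((2 * n - m + i : ℕ) + 1)) -
        μ.real (HEv 0 (2 * n) 0 (2 * n - m + i : ℕ))) := by
  have h := Finset.sum_range_sub
    (fun i : ℕ => μ.real (HEv 0 (2 * n) 0 (2 * n - m + i : ℕ))) m
  have e1 : ((2 * n - m + m : ℕ) : ℤ) = 2 * n := by omega
  have e2 : ((2 * n - m + 0 : ℕ) : ℤ) = 2 * n - m := by omega
  rw [e1, e2] at h
  rw [← h]
  refine Finset.sum_congr rfl fun i _ => ?_
  push_cast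
  congr 3

theorem le_measureReal_HEv_sub (hn : 1 ≤ n) (hmn : m ≤ n) :
    1 / 4096 * (m / n : ℝ) ≤
      μ.real (HEv 0 (2 * n) 0 (2 * n)) - μ.real (HEv 0 (2 * n) 0 (2 * n - m)) := by
  have := hμ.1
  have hn' : (0 : ℝ) < n := by exact_mod_cast hn
  rw [measureReal_HEv_sub_eq_sum hmn]
  have h : ∀ i ∈ Finset.range m, 1 / (4096 * n : ℝ) ≤
      μ.real (HEv 0 (2 * n) 0 ((2 * n - m + i : ℕ) + 1)) -
        μ.real (HEv 0 (2 * n) 0 (2 * n - m + i : ℕ)) := by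
    intro i hi
    rw [Finset.mem_range] at hi
    have hL : 2 * n - m + i + 1 ≤ 2 * n := by omega
    have hL' : n ≤ 2 * n - m + i := by omega
    generalize 2 * n - m + i = L at *
    have h1 := le_measureReal_HEv_succ_sub (x₀ := 0) (x₁ := 2 * n) hμ L
    have h2 := le_measureReal_HEv_rows hμ hn (k := L) (by exact_mod_cast hL')
    have h3 : μ.real (HEv 0 (2 * n) 0 L) ≤ 1 / 2 := by
      rw [← measureReal_HEv_square hμ (show (0 : ℤ) ≤ 2 * n by omega)]
      exact measureReal_mono (HEv_mono le_rfl (by omega))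
    have h4 : (L + 1 : ℝ) ≤ 2 * n := by exact_mod_cast hL
    have h5 : 0 ≤ μ.real (HEv 0 (2 * n) 0 (L + 1)) - μ.real (HEv 0 (2 * n) 0 L) :=
      sub_nonneg.2 (measureReal_mono (HEv_mono le_rfl (by omega)))
    rw [div_le_iff₀ (by positivity)]
    nlinarith [mul_le_mul_of_nonneg_right h4 h5]
  have h' := Finset.card_nsmul_le_sum _ _ _ h
  rw [Finset.card_range, nsmul_eq_mul] at h'
  refine le_trans (le_of_eq ?_) h'
  field_simp

theorem measureReal_HEv_sub_le (hn : 1 ≤ n) (hmn : m ≤ n) :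
    μ.real (HEv 0 (2 * n) 0 (2 * n)) - μ.real (HEv 0 (2 * n) 0 (2 * n - m)) ≤
      2048 * (m / n : ℝ) := by
  have := hμ.1
  have hn' : (0 : ℝ) < n := by exact_mod_cast hn
  rw [← mul_div_assoc, le_div_iff₀ hn']
  by_cases h2m : n < 2 * m
  · have h1 : (n : ℝ) ≤ 2 * m := by exact_mod_cast h2m.le
    have h2 : μ.real (HEv 0 (2 * n) 0 (2 * n)) ≤ 1 := measureReal_le_one
    have h3 : 0 ≤ μ.real (HEv 0 (2 * n) 0 (2 * n - m)) := measureReal_nonneg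
    nlinarith
  rw [measureReal_HEv_sub_eq_sum hmn]
  have h : ∀ i ∈ Finset.range m, μ.real (HEv 0 (2 * n) 0 ((2 * n - m + i : ℕ) + 1)) -
      μ.real (HEv 0 (2 * n) 0 (2 * n - m + i : ℕ)) ≤ 2048 / n := by
    intro i hi
    rw [Finset.mem_range] at hi
    have hL : 2 * n - m + i + 1 ≤ 2 * n := by omega
    have hL' : n + (n - m + 1) ≤ 2 * n - m + i + 1 := by omega
    generalize 2 * n - m + i = L at *
    have h1 := measureReal_HEv_succ_sub_le (x₀ := 0) (x₁ := 2 * n) (L := L) (W := n - m + 1)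
      (by omega) (by omega) hμ
    have h2 := le_measureReal_HEv_rows hμ hn (k := (L : ℤ) + 1 - (n - m + 1 : ℕ)) (by omega)
    have h4 : (n : ℝ) ≤ 2 * (n - m + 1 : ℕ) := by
      have : n ≤ 2 * (n - m + 1) := by omega
      exact_mod_cast this
    have h5 : 0 ≤ μ.real (HEv 0 (2 * n) 0 (L + 1)) - μ.real (HEv 0 (2 * n) 0 L) :=
      sub_nonneg.2 (measureReal_mono (HEv_mono le_rfl (by omega)))
    rw [le_div_iff₀ hn']
    generalize μ.real (HEv 0 (2 * n) 0 (L + 1)) - μ.real (HEv 0 (2 * n) 0 L) = d at *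
    generalize μ.real (HEv 0 (2 * n) 0 (L + 1 - (n - m + 1 : ℕ))) = c at *
    generalize ((n - m + 1 : ℕ) : ℝ) = W at *
    have h6 : 0 ≤ W * d := mul_nonneg (by linarith) h5
    nlinarith [mul_le_mul_of_nonneg_left h2 h6, mul_le_mul_of_nonneg_right h4 h5]
  have h' := Finset.sum_le_card_nsmul _ _ _ h
  rw [Finset.card_range, nsmul_eq_mul, mul_div_assoc', le_div_iff₀ hn'] at h'
  linarith

end Bounds

/-! ### The highest crossing -/

theorem List.IsChain.conn {p : List Site} (hp : p.IsChain Adj) {a b : Site} (ha : p.head? = some a)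
    (hb : p.getLast? = some b) : Conn {w | w ∈ p} a b := by
  induction p generalizing a with
  | nil => simp at ha
  | cons x l ih =>
    obtain rfl : x = a := by simpa using ha
    cases l with
    | nil =>
      obtain rfl : x = b := by simpa using hb
      exact Conn.refl (by simp)
    | cons y l =>
      rw [List.isChain_cons_cons] at hp
      exact ((ih hp.2 rfl (by simpa using hb)).mono fun w hw => List.mem_cons_of_mem _ hw).head
        (by simp) hp.1

theorem Conn.exists_path {S : Set Site} {u v : Site} (h : Conn S u v) :
    ∃ p, PathIn S p ∧ p.head? = some u ∧ p.getLast? = some v := by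
  have hv := h.right_mem
  refine h.head_induct (P := fun u => ∃ p, PathIn S p ∧ p.head? = some u ∧ p.getLast? = some v)
    (fun _ => ⟨[v], ⟨⟨by simp, by simp, List.isChain_singleton v⟩, by simp [hv]⟩, rfl, rfl⟩) ?_
  rintro x y hx hxy - ⟨p, ⟨⟨h1, h2, h3⟩, h4⟩, h5, h6⟩
  by_cases hxp : x ∈ p
  · obtain ⟨s, t, rfl⟩ := List.append_of_mem hxp
    refine ⟨x :: t, ⟨⟨by simp, h2.of_append_right, List.IsChain.right_of_append h3⟩,
      fun w hw => h4 w (List.mem_append_right _ hw)⟩, rfl, ?_⟩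
    rwa [List.getLast?_append_of_ne_nil _ (by simp)] at h6
  · refine ⟨x :: p, ⟨⟨by simp, List.nodup_cons.2 ⟨hxp, h2⟩, ?_⟩, ?_⟩, rfl, ?_⟩
    · obtain ⟨z, l, rfl⟩ := List.exists_cons_of_ne_nil h1
      obtain rfl : z = y := by simpa using h5
      exact List.isChain_cons_cons.2 ⟨hxy, h3⟩
    · exact List.forall_mem_cons.2 ⟨hx, h4⟩
    · rw [List.getLast?_cons, h6]
      rfl

section Highest

variable {x₀ x₁ y₀ y₁ : ℤ} {ω : Config} {p : List Site}

theorem HorizCrossing.crosses (h : HorizCrossing x₀ x₁ y₀ y₁ ω p) :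
    Crosses {w | w ∈ p} {v | v.1 = x₀} {v | v.1 = x₁} := by
  obtain ⟨⟨⟨-, -, hc⟩, -⟩, -, ⟨a, ha, ha'⟩, b, hb, hb'⟩ := h
  exact ⟨a, ha.2, b, hb.2, List.IsChain.conn hc ha' hb'⟩

theorem HorizCrossing.subset (h : HorizCrossing x₀ x₁ y₀ y₁ ω p) :
    {w | w ∈ p} ⊆ rect x₀ x₁ y₀ y₁ ∩ openSet ω := fun w hw => ⟨h.1.2 w hw, h.2.1 w hw⟩

theorem HorizCrossing.mono {y₀' y₁' : ℤ} (h : HorizCrossing x₀ x₁ y₀ y₁ ω p) (h0 : y₀' ≤ y₀)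
    (h1 : y₁ ≤ y₁') : HorizCrossing x₀ x₁ y₀' y₁' ω p := by
  have hr : rect x₀ x₁ y₀ y₁ ⊆ rect x₀ x₁ y₀' y₁' :=
    fun v hv => by rw [mem_rect] at *; omega
  obtain ⟨⟨h1, h2⟩, h3, ⟨a, ha, ha'⟩, b, hb, hb'⟩ := h
  exact ⟨⟨h1, fun v hv => hr (h2 v hv)⟩, h3, ⟨a, ⟨hr ha.1, ha.2⟩, ha'⟩, b, ⟨hr hb.1, hb.2⟩, hb'⟩

theorem Crosses.exists_horizCrossing {S : Set Site} (hS : S ⊆ rect x₀ x₁ y₀ y₁ ∩ openSet ω)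
    (h : Crosses S {v | v.1 = x₀} {v | v.1 = x₁}) :
    ∃ p, HorizCrossing x₀ x₁ y₀ y₁ ω p ∧ ∀ v ∈ p, v ∈ S := by
  obtain ⟨a, ha, b, hb, h⟩ := h
  have ha' := (hS h.left_mem).1
  have hb' := (hS h.right_mem).1
  obtain ⟨p, hp, h1, h2⟩ := h.exists_path
  exact ⟨p, ⟨⟨hp.1, fun v hv => (hS (hp.2 v hv)).1⟩, fun v hv => (hS (hp.2 v hv)).2,
    ⟨a, ⟨ha', ha⟩, h1⟩, b, ⟨hb', hb⟩, h2⟩, hp.2⟩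

theorem mem_HEv_iff_exists_horizCrossing :
    ω ∈ HEv x₀ x₁ y₀ y₁ ↔ ∃ p, HorizCrossing x₀ x₁ y₀ y₁ ω p := by
  constructor
  · intro h
    obtain ⟨p, hp, -⟩ := Crosses.exists_horizCrossing subset_rfl h
    exact ⟨p, hp⟩
  · rintro ⟨p, hp⟩
    exact hp.crosses.mono hp.subset

theorem exists_isHighestCrossing (hx : x₀ ≤ x₁) (hy : y₀ ≤ y₁) (h : ω ∈ HEv x₀ x₁ y₀ y₁) :
    ∃ p, IsHighestCrossing x₀ x₁ y₀ y₁ ω p := by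
  have hC := (isQuad_rect hx hy).crosses_diff_Low (C := openSet ω) (B := {v | v.2 = y₀}) h
  obtain ⟨p, hp, hpS⟩ := hC.exists_horizCrossing Set.sdiff_subset
  refine ⟨p, hp, fun q hq v hv => ⟨hp.1.2 v hv, or_iff_not_imp_left.2 fun hvq => ?_⟩⟩
  rintro ⟨r, hr, hrv, b, hb, hrb⟩
  refine (hpS v hv).2 ⟨{w | w ∈ q}, hq.subset, hq.crosses, b, hb.2, ?_⟩
  exact (List.IsChain.conn hr.1.2.2 hrv hrb).mono hr.2

/-- The highest crossing reaches below height `y` iff the part of the rectangle at height at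
least `y` is not crossed. -/
theorem IsHighestCrossing.exists_lt_iff {y : ℤ} (h0 : y₀ ≤ y)
    (hp : IsHighestCrossing x₀ x₁ y₀ y₁ ω p) :
    (∃ v ∈ p, v.2 < y) ↔ ω ∉ HEv x₀ x₁ y y₁ := by
  constructor
  · rintro ⟨v, hv, hvy⟩ h
    obtain ⟨q, hq⟩ := mem_HEv_iff_exists_horizCrossing.1 h
    have hvr := mem_rect.1 (hp.1.1.2 v hv)
    obtain ⟨-, hvq | hvq⟩ := hp.2 q (hq.mono h0 le_rfl) v hv
    · have := mem_rect.1 (hq.1.2 v hvq)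
      omega
    · have hc : Conn (rect x₀ x₁ y₀ y₁ \ {w | w ∈ q}) (v.1, y₀) (v.1, v.2) := by
        refine Conn.vline hvr.2.2.1 fun i hi hi' => ⟨?_, fun hq' => ?_⟩
        · rw [mem_rect]
          dsimp only
          omega
        · have := mem_rect.1 (hq.1.2 _ hq')
          dsimp only at this
          omega
      obtain ⟨r, hr, h1, h2⟩ := hc.symm.exists_path
      exact hvq ⟨r, hr, h1, _, ⟨hc.left_mem.1, rfl⟩, h2⟩
  · intro h
    by_contra! hlt
    refine h (mem_HEv_iff_exists_horizCrossing.2 ⟨p, ?_⟩)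
    have hr : ∀ v ∈ p, v ∈ rect x₀ x₁ y y₁ := fun v hv => by
      have h1 := mem_rect.1 (hp.1.1.2 v hv)
      have := hlt v hv
      rw [mem_rect]
      omega
    obtain ⟨⟨⟨h1, -⟩, h3, ⟨a, ha, ha'⟩, b, hb, hb'⟩, -⟩ := hp
    exact ⟨⟨h1, hr⟩, h3, ⟨a, ⟨hr a (List.mem_of_head? ha'), ha.2⟩, ha'⟩, b,
      ⟨hr b (List.mem_of_getLast? hb'), hb.2⟩, hb'⟩

end Highest

theorem setOf_Mhc_lt {n m : ℕ} (hmn : m ≤ n) :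
    {ω | Mhc n ω < m} = HEv (-n) n (-n) n \ HEv (-n) n (-n + m) n := by
  ext ω
  rw [Set.mem_ofPred_eq, Mhc]
  split_ifs with h
  · obtain ⟨p, hp⟩ := h
    have hH : ω ∈ HEv (-n) n (-n) n := mem_HEv_iff_exists_horizCrossing.2 ⟨p, hp.1⟩
    set s := {h : ℕ | ∃ p, IsHighestCrossing (-(n : ℤ)) n (-(n : ℤ)) n ω p ∧
        ∃ v ∈ p, v.2 + (n : ℤ) = (h : ℤ)}
    have hs : s.Nonempty := by
      obtain ⟨v, hv⟩ := List.exists_mem_of_ne_nil p hp.1.1.1.1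
      have := mem_rect.1 (hp.1.1.2 v hv)
      exact ⟨(v.2 + n).toNat, p, hp, v, hv, by omega⟩
    constructor
    · intro hlt
      obtain ⟨p', hp', v, hv, hvs⟩ := Nat.sInf_mem hs
      exact ⟨hH, (hp'.exists_lt_iff (by omega)).1 ⟨v, hv, by omega⟩⟩
    · rintro ⟨-, h⟩
      obtain ⟨v, hv, hlt⟩ := (hp.exists_lt_iff (by omega)).2 h
      have := mem_rect.1 (hp.1.1.2 v hv)
      have hle : sInf s ≤ (v.2 + n).toNat := Nat.sInf_le ⟨p, hp, v, hv, by omega⟩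
      omega
  · have hH : ω ∉ HEv (-n) n (-n) n :=
      fun hH => h (exists_isHighestCrossing (by omega) (by omega) hH)
    exact ⟨fun hlt => by omega, fun h => absurd h.1 hH⟩

/-- There exist constants `0 < c ≤ C < ∞` such that for every integer `n ≥ 1`
and every integer `1 ≤ m ≤ n`, `c·m/n ≤ P(M_n^{hc} < m) ≤ C·m/n`. -/
theorem statement19 :
    ∃ c C : ℝ≥0∞, 0 < c ∧ c ≤ C ∧ C < ⊤ ∧
      ∀ μ : Measure Config, IsBernoulliHalf μ →
        ∀ n m : ℕ, 1 ≤ n → 1 ≤ m → m ≤ n →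
          c * m / n ≤ μ {ω | Mhc n ω < m} ∧
            μ {ω | Mhc n ω < m} ≤ C * m / n := by
  refine ⟨ENNReal.ofReal (1 / 4096), ENNReal.ofReal 2048, by simp,
    ENNReal.ofReal_le_ofReal (by norm_num), ENNReal.ofReal_lt_top, fun μ hμ n m hn _ hmn => ?_⟩
  have := hμ.1
  have h1 := measureReal_HEv_translate hμ (x₀ := 0) (x₁ := 2 * n) (y₀ := 0) (y₁ := 2 * n) (-n) (-n)
  have h2 := measureReal_HEv_rows hμ (x₀ := -n) (x₁ := n) (-n + m) (2 * n - m)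
  have h3 := measureReal_HEv_translate hμ (x₀ := 0) (x₁ := 2 * n) (y₀ := 0) (y₁ := 2 * n - m) (-n) 0
  have e1 : (0 : ℤ) + -n = -n := by ring
  have e2 : (2 * n : ℤ) + -n = n := by ring
  have e3 : (-n + m : ℤ) + (2 * n - m) = n := by ring
  rw [e1, e2] at h1
  rw [e3] at h2
  rw [e1, e2, add_zero, add_zero] at h3
  have hP : μ.real {ω | Mhc n ω < m} =
      μ.real (HEv 0 (2 * n) 0 (2 * n)) - μ.real (HEv 0 (2 * n) 0 (2 * n - m)) := by
    rw [setOf_Mhc_lt hmn, measureReal_HEv_sdiff hμ (by omega) le_rfl, h1, h2, h3]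
  have hc : ∀ x : ℝ, 0 ≤ x → ENNReal.ofReal x * m / n = ENNReal.ofReal (x * (m / n)) := by
    intro x hx
    rw [ENNReal.ofReal_mul hx, ENNReal.ofReal_div_of_pos (by exact_mod_cast hn),
      ENNReal.ofReal_natCast, ENNReal.ofReal_natCast, mul_div_assoc]
  rw [hc _ (by norm_num), hc _ (by norm_num), ← ofReal_measureReal, hP]
  exact ⟨ENNReal.ofReal_le_ofReal (le_measureReal_HEv_sub hμ hn hmn),
    ENNReal.ofReal_le_ofReal (measureReal_HEv_sub_le hμ hn hmn)⟩
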